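/- Let d ≥ 1 be an integer and let 0 < δ < d be a non-integer. There exist constants K₁, K₂ > 0 depending only on δ and d with the following property. Let C > 1 and 0 < ε ≤ 1/2, and set r₀ := exp(−exp(K₁ · (log(C/ε))^{K₂})). Let X ⊆ B(0,1) ⊆ ℝ^d be a compact set such that for any r₀ ≤ r₂ ≤ r₁ ≤ 1 and any x ∈ ℝ^d, the set X ∩ B(x, r₁) can be covered by at most C·(r₁/r₂)^δ balls of radius r₂. Let μ be a Radon measure supported on X satisfying μ(B(x, r₁)) ≤ C·r₁^δ for all x ∈ ℝ^d and all r₀ ≤ r₁ ≤ 1. Then E(μ, r₀) ≤ ε · r₀^δ. -/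

import Mathlib

open MeasureTheory Metric Set
open scoped ENNReal

/-- The additive energy `E(μ, r)` of a measure `μ` at scale `r`. -/
noncomputable def addEnergy {E : Type*} [NormedAddCommGroup E] [MeasurableSpace E]
    (μ : Measure E) (r : ℝ) : ℝ≥0∞ :=
  (μ.prod (μ.prod (μ.prod μ)))
    {p : E × E × E × E | ‖p.1 + p.2.1 - p.2.2.1 - p.2.2.2‖ ≤ r}
section AdditiveCombinatorics

open scoped Pointwise

variable {G : Type*} [AddCommGroup G] [DecidableEq G]

/-- The elements `a` of `A` for which `a - s` also lies in `A`. -/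
def diffSlice (A : Finset G) (s : G) : Finset G := A.filter fun a => a - s ∈ A

lemma mem_diffSlice {A : Finset G} {s a : G} : a ∈ diffSlice A s ↔ a ∈ A ∧ a - s ∈ A := by
  simp [diffSlice]

/-- The number of additive quadruples in `A`. -/
def quadEnergy (A : Finset G) : ℕ := ∑ s ∈ A - A, (diffSlice A s).card ^ 2

lemma diffSlice_eq_empty {A : Finset G} {s : G} (hs : s ∉ A - A) : diffSlice A s = ∅ := by
  refine Finset.eq_empty_of_forall_notMem fun a ha => hs ?_
  rw [mem_diffSlice] at ha
  exact Finset.mem_sub.2 ⟨a, ha.1, a - s, ha.2, by abel⟩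

lemma sum_card_diffSlice_le (A : Finset G) :
    ∑ s ∈ A - A, (diffSlice A s).card ≤ A.card ^ 2 := by
  have h : ∀ s ∈ A - A, (diffSlice A s).card
      = ((A ×ˢ A).filter fun p => p.1 - p.2 = s).card := by
    intro s _
    refine Finset.card_bij' (fun a _ => (a, a - s)) (fun p _ => p.1) ?_ ?_ ?_ ?_
    · intro a ha
      rw [mem_diffSlice] at ha
      simp [ha.1, ha.2]
    · intro p hp
      simp only [Finset.mem_filter, Finset.mem_product] at hp
      rw [mem_diffSlice, ← hp.2]
      simp [hp.1.1, hp.1.2]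
    · intro a _
      rfl
    · intro p hp
      simp only [Finset.mem_filter, Finset.mem_product] at hp
      rw [← hp.2]
      simp
  rw [Finset.sum_congr rfl h, ← Finset.card_eq_sum_card_fiberwise]
  · rw [Finset.card_product, sq]
  · intro p hp
    simp only [Finset.coe_product, Set.mem_prod, Finset.mem_coe] at hp
    exact Finset.mem_sub.2 ⟨p.1, hp.1, p.2, hp.2, rfl⟩

/-- Every shifted quadruple count is at most the additive energy. -/
lemma card_quadruples_le (A : Finset G) (f : G) :
    ((A ×ˢ A ×ˢ A ×ˢ A).filter fun p => p.1 + p.2.1 - p.2.2.1 - p.2.2.2 = f).card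
      ≤ quadEnergy A := by
  have h1 : ((A ×ˢ A ×ˢ A ×ˢ A).filter fun p => p.1 + p.2.1 - p.2.2.1 - p.2.2.2 = f).card
      ≤ ∑ s ∈ A - A, (diffSlice A s).card * (diffSlice A (f - s)).card := by
    rw [Finset.card_eq_sum_card_fiberwise (f := fun p : G × G × G × G => p.1 - p.2.2.1)
      (t := A - A)]
    · refine Finset.sum_le_sum fun s _ => ?_
      rw [← Finset.card_product]
      refine Finset.card_le_card_of_injOn (fun p => (p.1, p.2.1)) ?_ ?_
      · intro p hp
        simp only [Finset.coe_filter, Finset.mem_filter, Finset.mem_product,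
          Set.mem_ofPred_eq] at hp
        obtain ⟨⟨⟨h1, h2, h3, h4⟩, h5⟩, h6⟩ := hp
        simp only [Finset.coe_product, Set.mem_prod, Finset.mem_coe, mem_diffSlice]
        refine ⟨⟨h1, ?_⟩, h2, ?_⟩
        · rw [← h6]
          simpa using h3
        · rw [← h5, ← h6]
          convert h4 using 1
          abel
      · intro p hp q hq hpq
        simp only [Finset.coe_filter, Finset.mem_filter, Set.mem_ofPred_eq] at hp hq
        obtain ⟨⟨_, h5⟩, h6⟩ := hp
        obtain ⟨⟨_, h5'⟩, h6'⟩ := hq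
        obtain ⟨p1, p2, p3, p4⟩ := p
        obtain ⟨q1, q2, q3, q4⟩ := q
        simp only [Prod.mk.injEq] at hpq h5 h6 h5' h6'
        obtain ⟨rfl, rfl⟩ := hpq
        have e3 : p3 = q3 := by
          have := h6.trans h6'.symm
          simpa using this
        subst e3
        have e4 : p4 = q4 := by
          have := h5.trans h5'.symm
          simpa using this
        rw [e4]
    · intro p hp
      simp only [Finset.coe_filter, Finset.mem_product, Set.mem_ofPred_eq] at hp
      exact Finset.mem_sub.2 ⟨p.1, hp.1.1, p.2.2.1, hp.1.2.2.1, rfl⟩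
  have h2 : ∑ s ∈ A - A, (diffSlice A (f - s)).card ^ 2 ≤ quadEnergy A := by
    have hinj : Set.InjOn (fun s : G => f - s) (A - A : Finset G) := by
      intro a _ b _ hab
      simpa using hab
    rw [← Finset.sum_image (f := fun t => (diffSlice A t).card ^ 2) hinj, quadEnergy]
    refine Finset.sum_le_sum_of_ne_zero fun t _ ht => ?_
    by_contra hcon
    exact ht (by rw [diffSlice_eq_empty hcon]; simp)
  have h3 : 2 * ∑ s ∈ A - A, (diffSlice A s).card * (diffSlice A (f - s)).card
      ≤ quadEnergy A + ∑ s ∈ A - A, (diffSlice A (f - s)).card ^ 2 := by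
    rw [quadEnergy, ← Finset.sum_add_distrib, Finset.mul_sum]
    refine Finset.sum_le_sum fun s _ => ?_
    rw [← mul_assoc]
    exact two_mul_le_add_sq _ _
  omega

/-- A pigeonhole step: some slice of `A` is large and has few unpopular differences. -/
lemma exists_popular_diffSlice {A : Finset G} (hA : A.Nonempty) {K : ℝ} (hK : 1 ≤ K)
    (hE : (A.card : ℝ) ^ 3 ≤ K * quadEnergy A) :
    ∃ s : G, (A.card : ℝ) ≤ 4 * K * (diffSlice A s).card ∧
      16 * ((((diffSlice A s) ×ˢ (diffSlice A s)).filter fun p =>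
        32 * K * ((diffSlice A (p.1 - p.2)).card : ℝ) < A.card).card : ℝ)
        ≤ ((diffSlice A s).card : ℝ) ^ 2 := by
  have hn : (0 : ℝ) < A.card := by exact_mod_cast hA.card_pos
  set B : G → ℕ := fun s => (((diffSlice A s) ×ˢ (diffSlice A s)).filter fun p =>
        32 * K * ((diffSlice A (p.1 - p.2)).card : ℝ) < A.card).card with hB
  have hbad : 32 * K * ((∑ s ∈ A - A, B s : ℕ) : ℝ) ≤ (A.card : ℝ) ^ 3 := by
    set bad := (A ×ˢ A).filter fun p =>
        32 * K * ((diffSlice A (p.1 - p.2)).card : ℝ) < A.card with hbaddef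
    have e1 : ∑ s ∈ A - A, B s ≤ ∑ p ∈ bad, (diffSlice A (p.1 - p.2)).card := by
      have e2 : ∀ s ∈ A - A, B s = (Finset.bipartiteAbove
          (fun (s : G) (p : G × G) => p.1 ∈ diffSlice A s ∧ p.2 ∈ diffSlice A s) bad s).card := by
        intro s _
        simp only [hB]
        congr 1
        ext p
        simp only [Finset.bipartiteAbove, hbaddef, Finset.mem_filter, Finset.mem_product,
          mem_diffSlice]
        tauto
      rw [Finset.sum_congr rfl e2, Finset.sum_card_bipartiteAbove_eq_sum_card_bipartiteBelow]
      refine Finset.sum_le_sum fun p _ => ?_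
      refine Finset.card_le_card_of_injOn (fun s => p.1 - s) ?_ ?_
      · intro s hs
        simp only [Finset.bipartiteBelow, Finset.coe_filter, mem_diffSlice,
          Set.mem_ofPred_eq] at hs
        simp only [Finset.mem_coe, mem_diffSlice]
        refine ⟨hs.2.1.2, ?_⟩
        convert hs.2.2.2 using 1
        abel
      · intro a _ b _ hab
        simpa using hab
    have e3 : 32 * K * ((∑ p ∈ bad, (diffSlice A (p.1 - p.2)).card : ℕ) : ℝ)
        ≤ bad.card * A.card := by
      push_cast
      rw [Finset.mul_sum, ← nsmul_eq_mul]
      refine Finset.sum_le_card_nsmul _ _ _ fun p hp => ?_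
      simp only [hbaddef, Finset.mem_filter] at hp
      exact hp.2.le
    have e4 : (bad.card : ℝ) ≤ (A.card : ℝ) ^ 2 := by
      have : bad.card ≤ A.card ^ 2 := by
        rw [sq, ← Finset.card_product]
        exact Finset.card_filter_le _ _
      exact_mod_cast this
    calc 32 * K * ((∑ s ∈ A - A, B s : ℕ) : ℝ)
        ≤ 32 * K * ((∑ p ∈ bad, (diffSlice A (p.1 - p.2)).card : ℕ) : ℝ) := by
          have : ((∑ s ∈ A - A, B s : ℕ) : ℝ)
            ≤ ((∑ p ∈ bad, (diffSlice A (p.1 - p.2)).card : ℕ) : ℝ) := by exact_mod_cast e1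
          gcongr
      _ ≤ bad.card * A.card := e3
      _ ≤ (A.card : ℝ) ^ 2 * A.card := by gcongr
      _ = (A.card : ℝ) ^ 3 := by ring
  have hlin : ((∑ s ∈ A - A, (diffSlice A s).card : ℕ) : ℝ) ≤ (A.card : ℝ) ^ 2 := by
    exact_mod_cast sum_card_diffSlice_le A
  have hex : ∃ s ∈ A - A, 0 < 4 * K * ((diffSlice A s).card : ℝ) ^ 2 - 64 * K * (B s : ℝ)
      - A.card * (diffSlice A s).card := by
    by_contra hcon
    push Not at hcon
    have hs := Finset.sum_nonpos hcon
    rw [Finset.sum_sub_distrib, Finset.sum_sub_distrib, ← Finset.mul_sum, ← Finset.mul_sum,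
      ← Finset.mul_sum] at hs
    rw [quadEnergy] at hE
    push_cast at hE hbad hlin
    have h4 : (A.card : ℝ) * ∑ s ∈ A - A, ((diffSlice A s).card : ℝ) ≤ A.card * A.card ^ 2 := by
      gcongr
    have h5 : (0 : ℝ) < (A.card : ℝ) ^ 3 := by positivity
    nlinarith
  obtain ⟨s, -, hs⟩ := hex
  have hBs : (0 : ℝ) ≤ B s := Nat.cast_nonneg _
  have hXs : (0 : ℝ) ≤ (diffSlice A s).card := Nat.cast_nonneg _
  have hK0 : 0 < K := by linarith
  refine ⟨s, ?_, ?_⟩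
  · have h6 : 0 < (diffSlice A s).card * (4 * K * ((diffSlice A s).card : ℝ) - A.card) := by
      nlinarith [mul_nonneg hK0.le hBs]
    have := pos_of_mul_pos_right h6 hXs
    linarith
  · have h7 : 0 < 4 * K * (((diffSlice A s).card : ℝ) ^ 2 - 16 * B s) := by
      nlinarith [mul_nonneg hn.le hXs]
    have := pos_of_mul_pos_right h7 (by positivity)
    linarith

/-- The **Balog–Szemerédi–Gowers theorem** with polynomial dependence. -/
theorem balog_szemeredi_gowers {A : Finset G} (hA : A.Nonempty) {K : ℝ} (hK : 1 ≤ K)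
    (hE : (A.card : ℝ) ^ 3 ≤ K * quadEnergy A) :
    ∃ A' ⊆ A, (A.card : ℝ) ≤ 8 * K * A'.card ∧
      ((A' - A').card : ℝ) ≤ 2 ^ 16 * K ^ 4 * A'.card := by
  obtain ⟨s, hX, hbad⟩ := exists_popular_diffSlice hA hK hE
  have hn : (0 : ℝ) < A.card := by exact_mod_cast hA.card_pos
  set X := diffSlice A s with hXdef
  have hK0 : 0 < K := by linarith
  have hXpos : (0 : ℝ) < X.card := by
    by_contra hcon
    have : (X.card : ℝ) = 0 := le_antisymm (not_lt.1 hcon) (Nat.cast_nonneg _)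
    rw [this] at hX
    linarith
  set bad : G → Finset G := fun a => X.filter fun b =>
    32 * K * ((diffSlice A (a - b)).card : ℝ) < A.card with hbaddef
  set A' := X.filter fun a => 4 * (bad a).card ≤ X.card with hA'
  have hcount : ((X ×ˢ X).filter fun p =>
        32 * K * ((diffSlice A (p.1 - p.2)).card : ℝ) < A.card).card = ∑ a ∈ X, (bad a).card := by
    rw [Finset.card_filter, Finset.sum_product]
    refine Finset.sum_congr rfl fun a _ => ?_
    simp only [hbaddef]
    rw [Finset.card_filter]
  have hA'card : (X.card : ℝ) ≤ 2 * A'.card := by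
    have h1 : (((X.filter fun a => ¬ 4 * (bad a).card ≤ X.card).card * X.card : ℕ) : ℝ)
        ≤ ((4 * ∑ a ∈ X, (bad a).card : ℕ) : ℝ) := by
      norm_cast
      rw [← smul_eq_mul, Finset.mul_sum]
      refine (Finset.card_nsmul_le_sum _ (fun a => 4 * (bad a).card) _ fun a ha => ?_).trans
        (Finset.sum_le_sum_of_subset (Finset.filter_subset _ _))
      simp only [Finset.mem_filter, not_le] at ha
      exact ha.2.le
    rw [hcount] at hbad
    have h2 := Finset.card_filter_add_card_filter_not (s := X)
      (fun a => 4 * (bad a).card ≤ X.card)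
    have h3 : ((X.filter fun a => ¬ 4 * (bad a).card ≤ X.card).card : ℝ)
      = X.card - A'.card := by
      have h2' : ((X.filter fun a => 4 * (bad a).card ≤ X.card).card : ℝ) +
          (X.filter fun a => ¬ 4 * (bad a).card ≤ X.card).card = X.card := by exact_mod_cast h2
      rw [← h2', hA']
      ring
    push_cast at h1 hbad
    rw [h3] at h1
    have h4 : X.card * (X.card : ℝ) ≤ X.card * (2 * A'.card) := by nlinarith
    exact le_of_mul_le_mul_left h4 hXpos
  refine ⟨A', (Finset.filter_subset _ _).trans (Finset.filter_subset _ _), by nlinarith, ?_⟩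
  set Q := A ×ˢ A ×ˢ A ×ˢ A with hQ
  have hfib : ∀ t ∈ A' - A', (X.card : ℝ) * A.card ^ 2 ≤ 2 * (32 * K) ^ 2 *
      (Q.filter fun p => (p.1 - p.2.1) - (p.2.2.1 - p.2.2.2) = t).card := by
    intro t ht
    obtain ⟨a, ha, a', ha', rfl⟩ := Finset.mem_sub.1 ht
    simp only [hA', Finset.mem_filter] at ha ha'
    set Y := (X \ bad a) \ bad a' with hY
    have hYcard : (X.card : ℝ) ≤ 2 * Y.card := by
      have h1 := Finset.le_card_sdiff (bad a) X
      have h2 := Finset.le_card_sdiff (bad a') (X \ bad a)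
      rw [← hY] at h2
      have : X.card ≤ 2 * Y.card := by omega
      exact_mod_cast this
    have hYmem : ∀ b ∈ Y, b ∈ X ∧ (A.card : ℝ) ≤ 32 * K * (diffSlice A (a - b)).card ∧
        (A.card : ℝ) ≤ 32 * K * (diffSlice A (a' - b)).card := by
      intro b hb
      simp only [hY, hbaddef, Finset.mem_sdiff, Finset.mem_filter, not_and, not_lt] at hb
      exact ⟨hb.1.1, hb.1.2 hb.1.1, hb.2 hb.1.1⟩
    have hsig : (Y.sigma fun b => diffSlice A (a - b) ×ˢ diffSlice A (a' - b)).card ≤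
        (Q.filter fun p => (p.1 - p.2.1) - (p.2.2.1 - p.2.2.2) = a - a').card := by
      refine Finset.card_le_card_of_injOn
        (fun x => (x.2.1, x.2.1 - (a - x.1), x.2.2, x.2.2 - (a' - x.1))) ?_ ?_
      · rintro ⟨b, u, u'⟩ hx
        simp only [Finset.coe_sigma, Set.mem_sigma_iff, Finset.mem_coe, Finset.mem_product,
          mem_diffSlice] at hx
        simp only [hQ, Finset.coe_filter, Finset.mem_product, Set.mem_ofPred_eq]
        refine ⟨⟨hx.2.1.1, hx.2.1.2, hx.2.2.1, hx.2.2.2⟩, by abel⟩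
      · rintro ⟨b, u, u'⟩ _ ⟨c, w, w'⟩ _ hxy
        simp only [Prod.mk.injEq] at hxy
        obtain ⟨rfl, h2, rfl, -⟩ := hxy
        have : b = c := by simpa using h2
        rw [this]
    have hsum : (Y.card : ℝ) * (A.card : ℝ) ^ 2 ≤ (32 * K) ^ 2 *
        (Y.sigma fun b => diffSlice A (a - b) ×ˢ diffSlice A (a' - b)).card := by
      rw [Finset.card_sigma]
      push_cast
      rw [Finset.mul_sum, ← nsmul_eq_mul]
      refine Finset.card_nsmul_le_sum _ _ _ fun b hb => ?_
      obtain ⟨-, h1, h2⟩ := hYmem b hb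
      rw [Finset.card_product]
      push_cast
      calc (A.card : ℝ) ^ 2 = A.card * A.card := sq _
        _ ≤ (32 * K * (diffSlice A (a - b)).card) * (32 * K * (diffSlice A (a' - b)).card) := by
          gcongr
        _ = _ := by ring
    have hsig' : ((Y.sigma fun b => diffSlice A (a - b) ×ˢ diffSlice A (a' - b)).card : ℝ) ≤
        (Q.filter fun p => (p.1 - p.2.1) - (p.2.2.1 - p.2.2.2) = a - a').card := by
      exact_mod_cast hsig
    have hK2 : 0 ≤ (32 * K) ^ 2 := by positivity
    have h3 : (X.card : ℝ) * A.card ^ 2 ≤ (2 * Y.card) * A.card ^ 2 := by gcongr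
    have h4 := mul_le_mul_of_nonneg_left hsig' hK2
    linarith
  have htot : ((A' - A').card : ℝ) * (X.card * (A.card : ℝ) ^ 2)
      ≤ 2 * (32 * K) ^ 2 * (A.card : ℝ) ^ 4 := by
    rw [← nsmul_eq_mul]
    refine (Finset.card_nsmul_le_sum _ _ _ hfib).trans ?_
    rw [← Finset.mul_sum]
    gcongr
    have : ∑ t ∈ A' - A',
        (Q.filter fun p => (p.1 - p.2.1) - (p.2.2.1 - p.2.2.2) = t).card ≤ A.card ^ 4 := by
      rw [Finset.sum_card_fiberwise_eq_card_filter]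
      refine (Finset.card_filter_le _ _).trans (le_of_eq ?_)
      simp only [hQ, Finset.card_product]
      ring
    exact_mod_cast this
  have hAX : (A.card : ℝ) ≤ 8 * K * A'.card := by nlinarith
  have h8 : ((A' - A').card : ℝ) * X.card ≤ 2 * (32 * K) ^ 2 * (A.card : ℝ) ^ 2 := by
    have h9 : (((A' - A').card : ℝ) * X.card) * A.card ^ 2
        ≤ (2 * (32 * K) ^ 2 * (A.card : ℝ) ^ 2) * A.card ^ 2 := by linarith
    exact le_of_mul_le_mul_right h9 (by positivity)
  have h10 : ((A' - A').card : ℝ) * X.card ≤ (2 ^ 16 * K ^ 4 * A'.card) * X.card := by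
    calc ((A' - A').card : ℝ) * X.card ≤ 2 * (32 * K) ^ 2 * (A.card : ℝ) ^ 2 := h8
      _ = 2 * (32 * K) ^ 2 * (A.card * A.card) := by ring
      _ ≤ 2 * (32 * K) ^ 2 * ((4 * K * X.card) * (8 * K * A'.card)) := by gcongr
      _ = 2 ^ 16 * K ^ 4 * A'.card * X.card := by ring
  exact le_of_mul_le_mul_right h10 hXpos

end AdditiveCombinatorics

section Bogolyubov

open scoped Pointwise

variable {H : Type*} [AddCommGroup H] [Fintype H]

lemma normSq_sum_addChar (B : Finset H) (χ : AddChar H ℂ) :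
    ((‖∑ b ∈ B, χ b‖ ^ 2 : ℝ) : ℂ) = ∑ p ∈ B ×ˢ B, χ (p.1 - p.2) := by
  push_cast
  rw [← Complex.mul_conj', map_sum, Finset.sum_mul_sum, Finset.sum_product]
  refine Finset.sum_congr rfl fun a _ => Finset.sum_congr rfl fun b _ => ?_
  rw [sub_eq_add_neg, AddChar.map_add_eq_mul, AddChar.map_neg_eq_conj]

variable [DecidableEq H]

lemma sum_normSq_sum_addChar (B : Finset H) :
    ∑ χ : AddChar H ℂ, ‖∑ b ∈ B, χ b‖ ^ 2 = (Fintype.card H : ℝ) * B.card := by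
  have h : ((∑ χ : AddChar H ℂ, ‖∑ b ∈ B, χ b‖ ^ 2 : ℝ) : ℂ)
      = ((Fintype.card H : ℝ) * B.card : ℝ) := by
    rw [Complex.ofReal_sum]
    simp_rw [normSq_sum_addChar]
    rw [Finset.sum_comm]
    simp_rw [AddChar.sum_apply_eq_ite, sub_eq_zero]
    rw [Finset.sum_product]
    simp [mul_comm]
  exact_mod_cast h

lemma sum_normSq_sq_mul_addChar_eq_zero (B : Finset H) {x : H} (hx : x ∉ (B + B) - (B + B)) :
    ∑ χ : AddChar H ℂ, (‖∑ b ∈ B, χ b‖ ^ 2) ^ 2 * (χ x).re = 0 := by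
  have h : ∑ χ : AddChar H ℂ, (((‖∑ b ∈ B, χ b‖ ^ 2) ^ 2 : ℝ) : ℂ) * χ x = 0 := by
    have h1 : ∀ χ : AddChar H ℂ, (((‖∑ b ∈ B, χ b‖ ^ 2) ^ 2 : ℝ) : ℂ) * χ x
        = ∑ p ∈ B ×ˢ B, ∑ r ∈ B ×ˢ B, χ (p.1 - p.2 + (r.1 - r.2) + x) := by
      intro χ
      rw [Complex.ofReal_pow, normSq_sum_addChar, sq, Finset.sum_mul_sum, Finset.sum_mul]
      refine Finset.sum_congr rfl fun p _ => ?_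
      rw [Finset.sum_mul]
      refine Finset.sum_congr rfl fun r _ => ?_
      rw [AddChar.map_add_eq_mul, AddChar.map_add_eq_mul]
    simp_rw [h1]
    rw [Finset.sum_comm]
    refine Finset.sum_eq_zero fun p hp => ?_
    rw [Finset.sum_comm]
    refine Finset.sum_eq_zero fun r hr => ?_
    rw [AddChar.sum_apply_eq_ite, if_neg]
    intro h0
    refine hx ?_
    rw [Finset.mem_product] at hp hr
    have hx' : x = (p.2 + r.2) - (p.1 + r.1) := by
      have : x = -(p.1 - p.2 + (r.1 - r.2)) := (neg_eq_of_add_eq_zero_right h0).symm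
      rw [this]
      abel
    rw [hx']
    exact Finset.sub_mem_sub (Finset.add_mem_add hp.2 hr.2) (Finset.add_mem_add hp.1 hr.1)
  have h2 := congrArg Complex.re h
  rw [Complex.re_sum] at h2
  simpa only [Complex.re_ofReal_mul, Complex.zero_re] using h2

/-- **Bogolyubov lemma**: if `B` has density `α`, then `2 • B - 2 • B` contains a Bohr set of
rank at most `4 / α ^ 2`. -/
theorem bogolyubov {B : Finset H} (hB : B.Nonempty) {α : ℝ} (hα : 0 < α)
    (hBα : α * Fintype.card H ≤ B.card) :
    ∃ Γ : Finset (AddChar H ℂ), (Γ.card : ℝ) ≤ 4 / α ^ 2 ∧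
      ∀ x, (∀ χ ∈ Γ, 0 ≤ (χ x).re) → x ∈ (B + B) - (B + B) := by
  classical
  set N : AddChar H ℂ → ℝ := fun χ => ‖∑ b ∈ B, χ b‖ ^ 2 with hN
  have hN0 : ∀ χ, 0 ≤ N χ := fun χ => by positivity
  have hb : (0 : ℝ) < B.card := by exact_mod_cast hB.card_pos
  have hq : (0 : ℝ) < Fintype.card H := by
    have : 0 < Fintype.card H := Fintype.card_pos
    exact_mod_cast this
  have hBq : (B.card : ℝ) ≤ Fintype.card H := by exact_mod_cast Finset.card_le_univ B
  have hα1 : α ≤ 1 := by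
    by_contra hcon
    push Not at hcon
    nlinarith
  have hpars : ∑ χ, N χ = Fintype.card H * B.card := sum_normSq_sum_addChar B
  refine ⟨Finset.univ.filter fun χ => α / 4 * (B.card : ℝ) ^ 2 ≤ N χ, ?_, ?_⟩
  · set Γ := Finset.univ.filter fun χ => α / 4 * (B.card : ℝ) ^ 2 ≤ N χ with hΓ
    have h1 : (Γ.card : ℝ) * (α / 4 * (B.card : ℝ) ^ 2) ≤ Fintype.card H * B.card := by
      rw [← hpars, ← nsmul_eq_mul]
      refine (Finset.card_nsmul_le_sum Γ N _ fun χ hχ => (Finset.mem_filter.1 hχ).2).trans ?_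
      exact Finset.sum_le_sum_of_subset_of_nonneg (Finset.subset_univ _) fun χ _ _ => hN0 χ
    rw [le_div_iff₀ (by positivity)]
    have h2 : (Γ.card : ℝ) * α ^ 2 * (Fintype.card H * B.card) ≤ 4 * (Fintype.card H * B.card) := by
      calc (Γ.card : ℝ) * α ^ 2 * (Fintype.card H * B.card)
          = Γ.card * α * (α * Fintype.card H) * B.card := by ring
        _ ≤ Γ.card * α * B.card * B.card := by gcongr
        _ = 4 * (Γ.card * (α / 4 * (B.card : ℝ) ^ 2)) := by ring
        _ ≤ _ := by gcongr
    exact le_of_mul_le_mul_right h2 (by positivity)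
  · intro x hx
    by_contra hcon
    have h0 := sum_normSq_sq_mul_addChar_eq_zero B hcon
    have hterm : ∀ χ : AddChar H ℂ, (if χ = 0 then (B.card : ℝ) ^ 4 else 0)
        - α / 4 * (B.card : ℝ) ^ 2 * N χ ≤ (N χ) ^ 2 * (χ x).re := by
      intro χ
      have hre : -1 ≤ (χ x).re := by
        have := Complex.abs_re_le_norm (χ x)
        rw [AddChar.norm_apply] at this
        exact (abs_le.1 this).1
      have hpos : 0 ≤ α / 4 * (B.card : ℝ) ^ 2 * N χ := by have := hN0 χ; positivity
      split_ifs with hχ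
      · subst hχ
        have : N 0 = (B.card : ℝ) ^ 2 := by simp [hN]
        rw [this] at hpos ⊢
        simp only [AddChar.zero_apply, Complex.one_re]
        nlinarith
      · by_cases hΓ : α / 4 * (B.card : ℝ) ^ 2 ≤ N χ
        · have := hx χ (by simp [hΓ])
          have : 0 ≤ (N χ) ^ 2 * (χ x).re := by positivity
          linarith
        · push Not at hΓ
          have h1 := mul_le_mul_of_nonneg_right hΓ.le (hN0 χ)
          nlinarith [sq_nonneg (N χ)]
    have hs := Finset.sum_le_sum fun χ (_ : χ ∈ (Finset.univ : Finset (AddChar H ℂ))) => hterm χ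
    rw [h0, Finset.sum_sub_distrib, ← Finset.mul_sum, hpars] at hs
    simp only [Finset.sum_ite_eq', Finset.mem_univ, if_true] at hs
    have h1 : α / 4 * (B.card : ℝ) ^ 2 * (Fintype.card H * B.card)
        ≤ (B.card : ℝ) ^ 4 / 4 := by
      calc α / 4 * (B.card : ℝ) ^ 2 * (Fintype.card H * B.card)
          = (α * Fintype.card H) * ((B.card : ℝ) ^ 3 / 4) := by ring
        _ ≤ B.card * ((B.card : ℝ) ^ 3 / 4) := by gcongr
        _ = _ := by ring
    have h2 : 0 < (B.card : ℝ) ^ 4 := by positivity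
    linarith

end Bogolyubov

section Modelling

open scoped Pointwise

/-- Some dilate modulo `q` pushes all elements of `S` away from zero. -/
lemma exists_dilate {q : ℕ} [Fact q.Prime] (S : Finset ℤ) (hS : ∀ s ∈ S, (s : ZMod q) ≠ 0)
    (h : ℕ) (hcard : S.card * (4 * h + 1) < q) :
    ∃ a : ZMod q, ∀ s ∈ S, ∀ j : ℤ, |j| ≤ 2 * h → a * s ≠ j := by
  set bad : Finset (ZMod q) := (S ×ˢ Finset.Icc (-(2 * h : ℤ)) (2 * h)).image
    fun p => (p.2 : ZMod q) / p.1 with hbad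
  have hlt : bad.card < Fintype.card (ZMod q) := by
    rw [ZMod.card]
    refine lt_of_le_of_lt Finset.card_image_le ?_
    rw [Finset.card_product, Int.card_Icc]
    have h1 : (2 * (h : ℤ) + 1 - -(2 * h)).toNat = 4 * h + 1 := by omega
    rwa [h1]
  obtain ⟨a, ha⟩ : ∃ a, a ∉ bad := by
    by_contra hcon
    push Not at hcon
    rw [Finset.eq_univ_iff_forall.2 hcon, Finset.card_univ] at hlt
    exact lt_irrefl _ hlt
  refine ⟨a, fun s hs j hj heq => ha ?_⟩
  rw [hbad, Finset.mem_image]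
  refine ⟨(s, j), ?_, ?_⟩
  · rw [Finset.mem_product, Finset.mem_Icc]
    exact ⟨hs, abs_le.1 hj⟩
  · simp only
    rw [← heq, mul_div_assoc, div_self (hS s hs), mul_one]

variable {G : Type*} [AddCommGroup G] [DecidableEq G]

/-- A set of small tripling admits a homomorphism to a cyclic group under which a thickening
of it is dense, while no nonzero element of `5 • A - 5 • A` is mapped near zero. -/
lemma exists_dense_model {A : Finset G} (hA : A.Nonempty) {ψ : G →+ ℤ}
    (hψ : ∀ s ∈ (A + A + A + A + A) - (A + A + A + A + A), s ≠ 0 → ψ s ≠ 0) {K : ℝ}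
    (hK : (((A + A + A + A + A) - (A + A + A + A + A)).card : ℝ) ≤ K * A.card) :
    ∃ (q h : ℕ) (_ : NeZero q) (φ : G →+ ZMod q) (B : Finset (ZMod q)), B.Nonempty ∧
      1 / (16 * K) * q ≤ B.card ∧
      (∀ b ∈ B, ∃ a ∈ A, ∃ j : ℤ, 0 ≤ j ∧ j < h ∧ b = φ a + j) ∧
      ∀ s ∈ (A + A + A + A + A) - (A + A + A + A + A), ∀ j : ℤ, |j| ≤ 2 * h →
        φ s = j → s = 0 := by
  set S := (A + A + A + A + A) - (A + A + A + A + A) with hS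
  obtain ⟨c, hc⟩ := hA
  have hsub : ∀ a ∈ A, ∀ b ∈ A, a - b ∈ S := by
    intro a ha b hb
    have : a - b = (a + c + c + c + c) - (b + c + c + c + c) := by abel
    rw [this]
    refine Finset.sub_mem_sub ?_ ?_ <;>
    repeat' apply Finset.add_mem_add
    all_goals assumption
  have hA0 : 0 < A.card := Finset.card_pos.2 ⟨c, hc⟩
  have hS0 : 0 < S.card := Finset.card_pos.2 ⟨_, hsub c hc c hc⟩
  obtain ⟨q, hq, hqp⟩ := Nat.exists_infinite_primes (16 * S.card + ∑ s ∈ S, (ψ s).natAbs + 1)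
  have : Fact q.Prime := ⟨hqp⟩
  set h := q / (8 * S.card) with hh
  have hmul : 8 * S.card * h ≤ q := Nat.mul_div_le q _
  have hh1 : q < 8 * S.card * (h + 1) := Nat.lt_mul_div_succ q (by positivity)
  have hqS : 16 * S.card < q := by omega
  set S' := (S.filter fun s => s ≠ 0).image ψ with hS'
  have hS'card : S'.card ≤ S.card := Finset.card_image_le.trans (Finset.card_filter_le _ _)
  obtain ⟨a, ha⟩ := exists_dilate (q := q) S' (by
    intro t ht
    rw [hS', Finset.mem_image] at ht
    obtain ⟨s, hs, rfl⟩ := ht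
    rw [Finset.mem_filter] at hs
    intro h0
    rw [ZMod.intCast_zmod_eq_zero_iff_dvd] at h0
    have h1 := Int.natAbs_dvd_natAbs.2 h0
    have h2 : (ψ s).natAbs ≤ ∑ s ∈ S, (ψ s).natAbs :=
      Finset.single_le_sum (f := fun s => (ψ s).natAbs) (fun _ _ => Nat.zero_le _) hs.1
    have h3 := Nat.le_of_dvd (Int.natAbs_pos.2 (hψ s hs.1 hs.2)) h1
    rw [Int.natAbs_natCast] at h3
    omega) h (by
    have : S'.card * (4 * h + 1) ≤ S.card * (4 * h + 1) := Nat.mul_le_mul_right _ hS'card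
    nlinarith)
  set φ : G →+ ZMod q := (AddMonoidHom.mulLeft a).comp ((Int.castAddHom (ZMod q)).comp ψ) with hφ
  have hφa : ∀ x, φ x = a * (ψ x : ZMod q) := fun x => by simp [hφ]
  have hφS : ∀ s ∈ S, ∀ j : ℤ, |j| ≤ 2 * h → φ s = j → s = 0 := by
    intro s hs j hj hsj
    by_contra hs0
    refine ha (ψ s) ?_ j hj (by rw [← hφa, hsj])
    rw [hS', Finset.mem_image]
    exact ⟨s, Finset.mem_filter.2 ⟨hs, hs0⟩, rfl⟩
  have hhq : h ≤ q := Nat.div_le_self _ _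
  have hinj : Set.InjOn (fun p : G × ℕ => φ p.1 + (p.2 : ZMod q))
      (A ×ˢ Finset.range h : Finset (G × ℕ)) := by
    rintro ⟨x, i⟩ hx ⟨y, j⟩ hy hxy
    simp only [Finset.coe_product, Set.mem_prod, Finset.mem_coe, Finset.mem_range] at hx hy hxy
    have h1 : φ (x - y) = ((j - i : ℤ) : ZMod q) := by
      rw [map_sub]
      push_cast
      linear_combination hxy
    have h2 : x - y = 0 := hφS _ (hsub x hx.1 y hy.1) _ (by rw [abs_le]; omega) h1
    have h3 : x = y := sub_eq_zero.1 h2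
    subst h3
    have h4 : (i : ZMod q) = j := add_left_cancel hxy
    have h5 : i = j := by
      rw [ZMod.natCast_eq_natCast_iff', Nat.mod_eq_of_lt (by omega),
        Nat.mod_eq_of_lt (by omega)] at h4
      exact h4
    rw [h5]
  have hhpos : 0 < h := Nat.div_pos (by omega) (by positivity)
  refine ⟨q, h, ⟨hqp.ne_zero⟩, φ,
    (A ×ˢ Finset.range h).image fun p => φ p.1 + (p.2 : ZMod q), ?_, ?_, ?_, hφS⟩
  · exact ⟨_, Finset.mem_image_of_mem _ (a := (c, 0)) (Finset.mem_product.2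
      ⟨hc, Finset.mem_range.2 hhpos⟩)⟩
  · rw [Finset.card_image_of_injOn hinj, Finset.card_product, Finset.card_range]
    have hqr : (q : ℝ) ≤ 16 * S.card * h := by
      have : q ≤ 16 * S.card * h := by nlinarith
      exact_mod_cast this
    have hAr : (0 : ℝ) < A.card := by exact_mod_cast hA0
    have hSr : (0 : ℝ) < S.card := by exact_mod_cast hS0
    have hK0 : 0 < K := by
      by_contra hcon
      nlinarith
    push_cast
    rw [div_mul_eq_mul_div, one_mul, div_le_iff₀ (by positivity)]
    calc (q : ℝ) ≤ 16 * S.card * h := hqr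
      _ ≤ 16 * (K * A.card) * h := by gcongr
      _ = _ := by ring
  · intro b hb
    rw [Finset.mem_image] at hb
    obtain ⟨⟨x, i⟩, hx, rfl⟩ := hb
    rw [Finset.mem_product, Finset.mem_range] at hx
    exact ⟨x, hx.1, i, by omega, by simpa using hx.2, by simp⟩

end Modelling

section BohrStructure

open scoped Pointwise

variable {G : Type*} [AddCommGroup G] [DecidableEq G]

/-- Distance from triviality of `x` with respect to finitely many characters. -/
noncomputable def bohrNorm {H : Type*} [AddCommGroup H] (Γ : Finset (AddChar H ℂ)) (x : H) : ℝ :=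
  (Γ.sup fun χ => ‖χ x - 1‖₊ : NNReal)

section

variable {H : Type*} [AddCommGroup H] (Γ : Finset (AddChar H ℂ))

lemma bohrNorm_nonneg (x : H) : 0 ≤ bohrNorm Γ x := NNReal.coe_nonneg _

lemma norm_sub_one_le_bohrNorm {χ : AddChar H ℂ} (hχ : χ ∈ Γ) (x : H) :
    ‖χ x - 1‖ ≤ bohrNorm Γ x := by
  have h := Finset.le_sup (f := fun χ : AddChar H ℂ => ‖χ x - 1‖₊) hχ
  exact_mod_cast h

lemma bohrNorm_le {x : H} {t : ℝ} (ht : 0 ≤ t) (h : ∀ χ ∈ Γ, ‖χ x - 1‖ ≤ t) :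
    bohrNorm Γ x ≤ t := by
  lift t to NNReal using ht
  have : (Γ.sup fun χ => ‖χ x - 1‖₊ : NNReal) ≤ t :=
    Finset.sup_le fun χ hχ => by exact_mod_cast h χ hχ
  exact_mod_cast this

lemma bohrNorm_zero : bohrNorm Γ 0 = 0 :=
  le_antisymm (bohrNorm_le Γ le_rfl fun χ _ => by simp) (bohrNorm_nonneg Γ 0)

lemma bohrNorm_add_le [Finite H] (x y : H) :
    bohrNorm Γ (x + y) ≤ bohrNorm Γ x + bohrNorm Γ y := by
  refine bohrNorm_le Γ (add_nonneg (bohrNorm_nonneg Γ x) (bohrNorm_nonneg Γ y)) fun χ hχ => ?_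
  have h1 : χ (x + y) - 1 = χ x * (χ y - 1) + (χ x - 1) := by
    rw [AddChar.map_add_eq_mul]
    ring
  rw [h1]
  refine (norm_add_le _ _).trans ?_
  rw [norm_mul, AddChar.norm_apply, one_mul, add_comm]
  exact add_le_add (norm_sub_one_le_bohrNorm Γ hχ x) (norm_sub_one_le_bohrNorm Γ hχ y)

lemma bohrNorm_neg_le [Finite H] (x : H) : bohrNorm Γ (-x) ≤ bohrNorm Γ x := by
  refine bohrNorm_le Γ (bohrNorm_nonneg Γ x) fun χ hχ => ?_
  refine le_trans (le_of_eq ?_) (norm_sub_one_le_bohrNorm Γ hχ x)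
  rw [AddChar.map_neg_eq_conj, ← Complex.norm_conj (χ x - 1)]
  simp

lemma re_nonneg_of_bohrNorm_le_one {x : H} (hx : bohrNorm Γ x ≤ 1) {χ : AddChar H ℂ}
    (hχ : χ ∈ Γ) : 0 ≤ (χ x).re := by
  have h1 := (norm_sub_one_le_bohrNorm Γ hχ x).trans hx
  have h2 := (abs_le.1 ((Complex.abs_re_le_norm (χ x - 1)).trans h1)).1
  simp only [Complex.sub_re, Complex.one_re] at h2
  linarith

/-- A finite set can be partitioned into boundedly many cells of small Bohr diameter. -/
lemma card_le_of_bohrNorm_cells [Finite H] {G' : Type*} [AddCommGroup G'] (φ : G' → H)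
    (hφ : ∀ a b, φ (a - b) = φ a - φ b) {ρ : ℝ} (hρ : 0 < ρ) (hρ1 : ρ ≤ 1) (S : Finset G') (m : ℝ)
    (hm : ∀ S' ⊆ S, (∀ a ∈ S', ∀ b ∈ S', bohrNorm Γ (φ (a - b)) ≤ ρ) → (S'.card : ℝ) ≤ m) :
    (S.card : ℝ) ≤ (7 / ρ) ^ (2 * Γ.card) * m := by
  have hm0 : 0 ≤ m := by simpa using hm ∅ (by simp) (by simp)
  set I : Finset ℤ := Finset.Icc ⌊-(2 / ρ)⌋ ⌊2 / ρ⌋ with hI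
  set T : Finset (Γ → ℤ × ℤ) := Fintype.piFinset fun _ => I ×ˢ I with hT
  set code : G' → (Γ → ℤ × ℤ) := fun a χ =>
    (⌊(χ.1 (φ a)).re * (2 / ρ)⌋, ⌊(χ.1 (φ a)).im * (2 / ρ)⌋) with hcode
  have hmaps : ∀ a ∈ S, code a ∈ T := by
    intro a _
    rw [hT, Fintype.mem_piFinset]
    intro χ
    have h1 := Complex.abs_re_le_norm (χ.1 (φ a))
    have h2 := Complex.abs_im_le_norm (χ.1 (φ a))
    rw [AddChar.norm_apply, abs_le] at h1 h2
    have h3 : (0 : ℝ) < 2 / ρ := by positivity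
    simp only [hcode, hI, Finset.mem_product, Finset.mem_Icc]
    refine ⟨⟨?_, ?_⟩, ?_, ?_⟩ <;> apply Int.floor_le_floor <;> nlinarith
  have hfib : ∀ c ∈ T, ((S.filter fun a => code a = c).card) ≤ ⌊m⌋₊ := by
    intro c _
    refine Nat.le_floor (hm _ (Finset.filter_subset _ _) fun a ha b hb => ?_)
    rw [Finset.mem_filter] at ha hb
    refine bohrNorm_le Γ hρ.le fun χ hχ => ?_
    have hab := congrFun (ha.2.trans hb.2.symm) ⟨χ, hχ⟩
    simp only [hcode, Prod.mk.injEq] at hab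
    have h1 := Int.abs_sub_lt_one_of_floor_eq_floor hab.1
    have h2 := Int.abs_sub_lt_one_of_floor_eq_floor hab.2
    have h3 : (0 : ℝ) < 2 / ρ := by positivity
    rw [← sub_mul, abs_mul, abs_of_pos h3, ← lt_div_iff₀ h3] at h1 h2
    have h4 : χ (φ (a - b)) - 1 = (χ (φ a) - χ (φ b)) * χ (-φ b) := by
      rw [hφ, sub_eq_add_neg (φ a), AddChar.map_add_eq_mul, sub_mul,
        ← AddChar.map_add_eq_mul χ (φ b)]
      simp
    rw [h4, norm_mul, AddChar.norm_apply, mul_one]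
    refine (Complex.norm_le_abs_re_add_abs_im _).trans ?_
    rw [Complex.sub_re, Complex.sub_im]
    have h5 : 1 / (2 / ρ) = ρ / 2 := by field_simp
    rw [h5] at h1 h2
    linarith
  have hcard := Finset.card_le_mul_card_image_of_maps_to hmaps _ hfib
  have hTcard : (T.card : ℝ) ≤ (7 / ρ) ^ (2 * Γ.card) := by
    have h1 : T.card = I.card ^ (2 * Γ.card) := by
      rw [hT, Fintype.card_piFinset]
      simp only [Finset.card_product, Finset.prod_const, Finset.card_univ, Fintype.card_coe]
      rw [pow_mul, sq]
    have h2 : (I.card : ℝ) ≤ 7 / ρ := by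
      have h6 : (1 : ℝ) ≤ 1 / ρ := by rw [le_div_iff₀ hρ]; linarith
      have h3 : ((⌊2 / ρ⌋ + 1 - ⌊-(2 / ρ)⌋ : ℤ) : ℝ) ≤ 7 / ρ := by
        push_cast
        have h4 := Int.floor_le (2 / ρ)
        have h5 := Int.lt_floor_add_one (-(2 / ρ))
        have h7 : 7 / ρ = 7 * (1 / ρ) := by ring
        have h8 : 2 / ρ = 2 * (1 / ρ) := by ring
        rw [h7]
        rw [h8] at h4 h5 ⊢
        linarith
      have h9 : ((⌊2 / ρ⌋ + 1 - ⌊-(2 / ρ)⌋).toNat : ℤ) = ⌊2 / ρ⌋ + 1 - ⌊-(2 / ρ)⌋ := by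
        apply Int.toNat_of_nonneg
        have : ⌊-(2 / ρ)⌋ ≤ ⌊2 / ρ⌋ := Int.floor_le_floor (by
          have : (0 : ℝ) < 2 / ρ := by positivity
          linarith)
        omega
      rw [hI, Int.card_Icc]
      calc (((⌊2 / ρ⌋ + 1 - ⌊-(2 / ρ)⌋).toNat : ℕ) : ℝ)
          = (((⌊2 / ρ⌋ + 1 - ⌊-(2 / ρ)⌋).toNat : ℤ) : ℝ) := by push_cast; rfl
        _ ≤ 7 / ρ := by rw [h9]; exact h3
    rw [h1]
    push_cast
    gcongr
  calc (S.card : ℝ) ≤ (⌊m⌋₊ : ℝ) * T.card := by exact_mod_cast hcard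
    _ ≤ m * (7 / ρ) ^ (2 * Γ.card) := by
      gcongr
      exact Nat.floor_le hm0
    _ = _ := mul_comm _ _

end

/-- The elements that are sums of elements of `A - A` of total `p`-weight at most `t`. -/
def weightedSums (A : Finset G) (p : G → ℝ) (t : ℝ) : Set G :=
  {x | ∃ l : List G, (∀ y ∈ l, y ∈ A - A) ∧ (l.map p).sum ≤ t ∧ l.sum = x}

lemma zero_mem_weightedSums (A : Finset G) (p : G → ℝ) {t : ℝ} (ht : 0 ≤ t) :
    0 ∈ weightedSums A p t := ⟨[], by simp, by simpa using ht, by simp⟩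

lemma add_mem_weightedSums {A : Finset G} {p : G → ℝ} {s t : ℝ} {x y : G}
    (hx : x ∈ weightedSums A p s) (hy : y ∈ weightedSums A p t) :
    x + y ∈ weightedSums A p (s + t) := by
  obtain ⟨l, hl, hls, rfl⟩ := hx
  obtain ⟨l', hl', hls', rfl⟩ := hy
  refine ⟨l ++ l', ?_, ?_, by simp⟩
  · intro z hz
    rcases List.mem_append.1 hz with h | h
    · exact hl z h
    · exact hl' z h
  · rw [List.map_append, List.sum_append]
    exact add_le_add hls hls'

lemma zsmul_mem_weightedSums {A : Finset G} {p : G → ℝ} (hp : ∀ x, p (-x) ≤ p x) {v : G}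
    (hv : v ∈ A - A) {n : ℤ} {t : ℝ} (ht : |(n : ℝ)| * p v ≤ t) :
    n • v ∈ weightedSums A p t := by
  have hneg : -v ∈ A - A := by
    obtain ⟨a, ha, b, hb, rfl⟩ := Finset.mem_sub.1 hv
    rw [neg_sub]
    exact Finset.sub_mem_sub hb ha
  rcases le_total 0 n with hn | hn
  · lift n to ℕ using hn
    refine ⟨List.replicate n v, fun y hy => (List.eq_of_mem_replicate hy) ▸ hv, ?_, by simp⟩
    simpa using ht
  · obtain ⟨k, hk⟩ := Int.eq_ofNat_of_zero_le (show 0 ≤ -n by omega)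
    obtain rfl : n = -k := by omega
    refine ⟨List.replicate k (-v), fun y hy => (List.eq_of_mem_replicate hy) ▸ hneg, ?_, by simp⟩
    have h1 : (k : ℝ) * p (-v) ≤ k * p v := mul_le_mul_of_nonneg_left (hp v) (Nat.cast_nonneg k)
    push_cast at ht
    rw [abs_neg, Nat.abs_cast] at ht
    simpa using h1.trans ht

/-- **Bohr structure of sets of small doubling.** Arbitrarily small pieces of `A - A`, of
polynomially controlled density, can be added up many times while remaining in `2 • A - 2 • A`. -/
theorem exists_bohr_structure {A : Finset G} (hA : A.Nonempty) {ψ : G →+ ℤ}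
    (hψ : ∀ s ∈ (A + A + A + A + A) - (A + A + A + A + A), s ≠ 0 → ψ s ≠ 0) {K : ℝ}
    (hK0 : 0 < K)
    (hK : (((A + A + A + A + A) - (A + A + A + A + A)).card : ℝ) ≤ K * A.card) :
    ∃ (n : ℕ) (p : G → ℝ), (n : ℝ) ≤ 1024 * K ^ 2 ∧ (∀ x, 0 ≤ p x) ∧ (∀ x, p (-x) ≤ p x) ∧
      (∀ x ∈ weightedSums A p 1, x ∈ (A + A) - (A + A)) ∧
      ∀ ρ : ℝ, 0 < ρ → ρ ≤ 1 → ∀ (S : Finset G) (m : ℝ),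
        (∀ S' ⊆ S, (∀ a ∈ S', ∀ b ∈ S', p (a - b) ≤ ρ) → (S'.card : ℝ) ≤ m) →
        (S.card : ℝ) ≤ (7 / ρ) ^ (2 * n) * m := by
  obtain ⟨q, h, hq, φ, B, hB, hBq, hBA, hφ⟩ := exists_dense_model hA hψ hK
  obtain ⟨Γ, hΓ, hΓB⟩ := bogolyubov hB (α := 1 / (16 * K)) (by positivity)
    (by rwa [ZMod.card])
  have hBB : ∀ b ∈ B + B - (B + B), ∃ z ∈ A + A - (A + A), ∃ j : ℤ, |j| ≤ 2 * h ∧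
      b = φ z + j := by
    intro b hb
    obtain ⟨_, h12, _, h34, rfl⟩ := Finset.mem_sub.1 hb
    obtain ⟨b1, h1, b2, h2, rfl⟩ := Finset.mem_add.1 h12
    obtain ⟨b3, h3, b4, h4, rfl⟩ := Finset.mem_add.1 h34
    obtain ⟨a1, ha1, j1, hj1, hj1', rfl⟩ := hBA b1 h1
    obtain ⟨a2, ha2, j2, hj2, hj2', rfl⟩ := hBA b2 h2
    obtain ⟨a3, ha3, j3, hj3, hj3', rfl⟩ := hBA b3 h3
    obtain ⟨a4, ha4, j4, hj4, hj4', rfl⟩ := hBA b4 h4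
    refine ⟨(a1 + a2) - (a3 + a4), Finset.sub_mem_sub (Finset.add_mem_add ha1 ha2)
      (Finset.add_mem_add ha3 ha4), j1 + j2 - (j3 + j4), ?_, ?_⟩
    · rw [abs_le]
      omega
    · simp only [map_sub, map_add]
      push_cast
      ring
  refine ⟨Γ.card, fun x => bohrNorm Γ (φ x), ?_, fun x => bohrNorm_nonneg Γ _, fun x => ?_, ?_, ?_⟩
  · refine hΓ.trans (le_of_eq ?_)
    field_simp
    norm_num
  · simp only [map_neg]
    exact bohrNorm_neg_le Γ _
  · have key : ∀ l : List G, (∀ y ∈ l, y ∈ A - A) →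
        (l.map fun x => bohrNorm Γ (φ x)).sum ≤ 1 →
        bohrNorm Γ (φ l.sum) ≤ (l.map fun x => bohrNorm Γ (φ x)).sum ∧
          l.sum ∈ A + A - (A + A) := by
      intro l
      induction l with
      | nil =>
        intro _ _
        obtain ⟨c, hc⟩ := hA
        refine ⟨by simp [bohrNorm_zero], ?_⟩
        have : (0 : G) = (c + c) - (c + c) := by abel
        rw [List.sum_nil, this]
        exact Finset.sub_mem_sub (Finset.add_mem_add hc hc) (Finset.add_mem_add hc hc)
      | cons x l ih =>
        intro hl hsum
        rw [List.map_cons, List.sum_cons] at hsum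
        have hx0 := bohrNorm_nonneg Γ (φ x)
        obtain ⟨ih1, ih2⟩ := ih (fun y hy => hl y (List.mem_cons_of_mem _ hy)) (by linarith)
        have hn : bohrNorm Γ (φ (x + l.sum)) ≤
            bohrNorm Γ (φ x) + (l.map fun x => bohrNorm Γ (φ x)).sum := by
          rw [map_add]
          exact (bohrNorm_add_le Γ _ _).trans (by linarith)
        rw [List.map_cons, List.sum_cons, List.sum_cons]
        refine ⟨hn, ?_⟩
        obtain ⟨z, hz, j, hj, hzj⟩ := hBB (φ (x + l.sum)) (hΓB _ fun χ hχ =>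
          re_nonneg_of_bohrNorm_le_one Γ (hn.trans hsum) hχ)
        have hmem : x + l.sum - z ∈ (A + A + A + A + A) - (A + A + A + A + A) := by
          obtain ⟨a1, h1, a2, h2, rfl⟩ := Finset.mem_sub.1 (hl x List.mem_cons_self)
          obtain ⟨_, h34, _, h56, hs⟩ := Finset.mem_sub.1 ih2
          obtain ⟨a3, h3, a4, h4, rfl⟩ := Finset.mem_add.1 h34
          obtain ⟨a5, h5, a6, h6, rfl⟩ := Finset.mem_add.1 h56
          obtain ⟨_, h34', _, h56', rfl⟩ := Finset.mem_sub.1 hz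
          obtain ⟨b3, h3', b4, h4', rfl⟩ := Finset.mem_add.1 h34'
          obtain ⟨b5, h5', b6, h6', rfl⟩ := Finset.mem_add.1 h56'
          rw [← hs]
          have : a1 - a2 + (a3 + a4 - (a5 + a6)) - (b3 + b4 - (b5 + b6))
            = (a1 + a3 + a4 + b5 + b6) - (a2 + a5 + a6 + b3 + b4) := by abel
          rw [this]
          refine Finset.sub_mem_sub ?_ ?_ <;>
          repeat' apply Finset.add_mem_add
          all_goals assumption
        have h0 := hφ _ hmem j hj (by rw [map_sub, hzj]; ring)
        rw [sub_eq_zero.1 h0]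
        exact hz
    rintro x ⟨l, hl, hls, rfl⟩
    exact (key l hl hls).2
  · intro ρ hρ hρ1 S m hm
    exact card_le_of_bohrNorm_cells Γ φ (map_sub φ) hρ hρ1 S m hm

end BohrStructure

/-- Finitely many nonzero integer vectors are simultaneously not annihilated by some functional. -/
lemma exists_addMonoidHom_ne_zero {d : ℕ} (S : Finset (Fin d → ℤ)) :
    ∃ ψ : (Fin d → ℤ) →+ ℤ, ∀ s ∈ S, s ≠ 0 → ψ s ≠ 0 := by
  classical
  set P : (Fin d → ℤ) → Polynomial ℤ :=
    fun s => ∑ i, Polynomial.C (s i) * Polynomial.X ^ (i : ℕ) with hP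
  have hP0 : ∀ s, s ≠ 0 → P s ≠ 0 := by
    intro s hs h
    refine hs (funext fun i => ?_)
    have h1 := congrArg (fun f => Polynomial.coeff f (i : ℕ)) h
    simpa [hP, Polynomial.finsetSum_coeff, Polynomial.coeff_C_mul, Polynomial.coeff_X_pow,
      Fin.val_inj] using h1
  have hprod : ∏ s ∈ S.filter (· ≠ 0), P s ≠ 0 :=
    Finset.prod_ne_zero_iff.2 fun s hs => hP0 s (Finset.mem_filter.1 hs).2
  obtain ⟨M, hM⟩ : ∃ M : ℤ, (∏ s ∈ S.filter (· ≠ 0), P s).eval M ≠ 0 := by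
    by_contra! h
    exact hprod (Polynomial.funext fun r => by rw [h r, Polynomial.eval_zero])
  refine ⟨⟨⟨fun x => ∑ i, x i * M ^ (i : ℕ), by simp⟩, fun x y => by
    simp [add_mul, Finset.sum_add_distrib]⟩, fun s hs hs0 => ?_⟩
  rw [Polynomial.eval_prod] at hM
  have h2 := Finset.prod_ne_zero_iff.1 hM s (Finset.mem_filter.2 ⟨hs, hs0⟩)
  simpa [hP, Polynomial.eval_finsetSum] using h2

section Filling

open scoped Pointwise

variable {G : Type*} [AddCommGroup G] [DecidableEq G]
variable {E : Type*} [NormedAddCommGroup E] [InnerProductSpace ℝ E] [FiniteDimensional ℝ E]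

/-- The `L`-ball of the subspace `V` is approximated up to `r` by images of weighted sums. -/
def ApproximatesSubspace (A : Finset G) (p : G → ℝ) (ι : G →+ E) (V : Submodule ℝ E)
    (t r L : ℝ) : Prop :=
  ∀ u ∈ V, ‖u‖ ≤ L → ∃ x ∈ weightedSums A p t, ‖ι x - u‖ ≤ r

/-- Adding multiples of an increment transverse to `V` to an approximation of `V`. -/
lemma ApproximatesSubspace.sup_span_singleton {A : Finset G} {p : G → ℝ} (hp0 : ∀ x, 0 ≤ p x)
    (hp : ∀ x, p (-x) ≤ p x) {ι : G →+ E} {V : Submodule ℝ E} {t r L : ℝ}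
    (hV : ApproximatesSubspace A p ι V t r L) {v : G} (hv : v ∈ A - A) {ρ R k : ℝ}
    (hρ : p v ≤ ρ) (hR : ‖ι v‖ ≤ R) (hr : r < ‖ι v - V.starProjection (ι v)‖) (hr0 : 0 ≤ r)
    (hk : 1 ≤ k) (hkL : 3 * k * R ≤ L) :
    ApproximatesSubspace A p ι (V ⊔ Submodule.span ℝ {ι v - V.starProjection (ι v)})
      (t + 2 * k * ρ) (2 * ‖ι v - V.starProjection (ι v)‖)
      (k * ‖ι v - V.starProjection (ι v)‖) := by
  set P := V.starProjection (ι v) with hP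
  set w := ι v - P with hw
  have hPV : P ∈ V := V.starProjection_apply_mem _
  have hwV : ∀ u ∈ V, inner ℝ u w = 0 := fun u hu =>
    (V.mem_orthogonal _).1 (V.sub_starProjection_mem_orthogonal (ι v)) u hu
  have hpyth : ‖ι v‖ * ‖ι v‖ = ‖P‖ * ‖P‖ + ‖w‖ * ‖w‖ := by
    rw [← norm_add_sq_eq_norm_sq_add_norm_sq_of_inner_eq_zero _ _ (hwV P hPV), hw]
    simp
  have hw0 : 0 < ‖w‖ := hr0.trans_lt hr
  have hR0 : 0 ≤ R := (norm_nonneg _).trans hR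
  have hPR : ‖P‖ ≤ R :=
    (abs_le_of_sq_le_sq' (by nlinarith [norm_nonneg w, norm_nonneg (ι v)]) hR0).2
  have hwR : ‖w‖ ≤ R :=
    (abs_le_of_sq_le_sq' (by nlinarith [norm_nonneg P, norm_nonneg (ι v)]) hR0).2
  intro u hu huL
  obtain ⟨u₀, hu₀, _, hs, rfl⟩ := Submodule.mem_sup.1 hu
  obtain ⟨s, rfl⟩ := Submodule.mem_span_singleton.1 hs
  have horth : inner ℝ u₀ (s • w) = 0 := by rw [inner_smul_right, hwV u₀ hu₀, mul_zero]
  have hpy := norm_add_sq_eq_norm_sq_add_norm_sq_of_inner_eq_zero _ _ horth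
  have hkw : 0 ≤ k * ‖w‖ := by positivity
  have hu₀n : ‖u₀‖ ≤ k * ‖w‖ :=
    (abs_le_of_sq_le_sq' (by nlinarith [norm_nonneg (u₀ + s • w)]) hkw).2
  have hsn : ‖s • w‖ ≤ k * ‖w‖ :=
    (abs_le_of_sq_le_sq' (by nlinarith [norm_nonneg (u₀ + s • w)]) hkw).2
  rw [norm_smul, Real.norm_eq_abs] at hsn
  have hsk : |s| ≤ k := le_of_mul_le_mul_right hsn hw0
  set n : ℤ := round s with hn
  have hsn2 : |s - n| ≤ 1 / 2 := abs_sub_round s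
  have hnk : |(n : ℝ)| ≤ 2 * k := by
    have : |(n : ℝ)| ≤ |s| + |s - n| := by
      have := abs_sub s (s - n)
      rwa [sub_sub_cancel] at this
    linarith
  have hu' : u₀ - (n : ℝ) • P ∈ V := V.sub_mem hu₀ (V.smul_mem _ hPV)
  have hu'L : ‖u₀ - (n : ℝ) • P‖ ≤ L := by
    refine (norm_sub_le _ _).trans ?_
    rw [norm_smul, Real.norm_eq_abs]
    have h1 : |(n : ℝ)| * ‖P‖ ≤ 2 * k * R := by gcongr
    have h2 : k * ‖w‖ ≤ k * R := by gcongr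
    linarith
  obtain ⟨x, hx, hxu⟩ := hV _ hu' hu'L
  refine ⟨x + n • v, add_mem_weightedSums hx (zsmul_mem_weightedSums hp hv ?_), ?_⟩
  · exact mul_le_mul hnk hρ (hp0 v) (by linarith)
  · have h1 : ι (x + n • v) - (u₀ + s • w) = (ι x - (u₀ - (n : ℝ) • P)) + ((n : ℝ) - s) • w := by
      rw [map_add, map_zsmul, ← Int.cast_smul_eq_zsmul ℝ n (ι v), hw]
      module
    rw [h1]
    refine (norm_add_le _ _).trans ?_
    rw [norm_smul, Real.norm_eq_abs, abs_sub_comm]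
    have : |s - n| * ‖w‖ ≤ 1 / 2 * ‖w‖ := by gcongr
    linarith

lemma finrank_sup_span_sub_starProjection (V : Submodule ℝ E) {v : E}
    (hv : v - V.starProjection v ≠ 0) :
    Module.finrank ℝ ↥(V ⊔ Submodule.span ℝ {v - V.starProjection v}) =
      Module.finrank ℝ V + 1 := by
  have h := Submodule.finrank_sup_add_finrank_inf_eq V (Submodule.span ℝ {v - V.starProjection v})
  rw [finrank_span_singleton hv] at h
  have h0 : V ⊓ Submodule.span ℝ {v - V.starProjection v} = ⊥ := by
    rw [eq_bot_iff]
    refine le_trans (inf_le_inf_left V ?_) V.inf_orthogonal_eq_bot.le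
    rw [Submodule.span_singleton_le_iff_mem]
    exact V.sub_starProjection_mem_orthogonal v
  rw [h0, finrank_bot] at h
  omega

/-- A set lying in a bounded slab around a subspace is covered by boundedly many pieces whose
diameter is comparable to the width of the slab. -/
lemma card_le_of_near_subspace {α : Type*} (f : α → E) (V : Submodule ℝ E) {r T : ℝ} (hr : 0 < r)
    (hT : 0 ≤ T) (S : Finset α) (c : E) (m : ℝ) (hS : ∀ a ∈ S, ‖f a - c‖ ≤ T)
    (hV : ∀ a ∈ S, ∀ b ∈ S, ‖(f a - f b) - V.starProjection (f a - f b)‖ ≤ r)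
    (hm : ∀ S' ⊆ S, (∀ a ∈ S', ∀ b ∈ S', ‖f a - f b‖ ≤ (Module.finrank ℝ V + 1) * r) →
      (S'.card : ℝ) ≤ m) :
    (S.card : ℝ) ≤ (2 * T / r + 2) ^ Module.finrank ℝ V * m := by
  classical
  have hm0 : 0 ≤ m := by simpa using hm ∅ (by simp) (by simp)
  set e := stdOrthonormalBasis ℝ V with he
  set I : Finset ℤ := Finset.Icc ⌊-(T / r)⌋ ⌊T / r⌋ with hI
  set code : α → (Fin (Module.finrank ℝ V) → ℤ) := fun a j => ⌊inner ℝ (e j : E) (f a - c) / r⌋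
    with hcode
  have hen : ∀ j, ‖(e j : E)‖ = 1 := fun j => e.norm_eq_one j
  have hTr : 0 ≤ T / r := by positivity
  have hmaps : ∀ a ∈ S, code a ∈ Fintype.piFinset fun _ : Fin (Module.finrank ℝ V) => I := by
    intro a ha
    rw [Fintype.mem_piFinset]
    intro j
    have h1 : |inner ℝ (e j : E) (f a - c)| ≤ T := by
      refine (abs_real_inner_le_norm _ _).trans ?_
      rw [hen, one_mul]
      exact hS a ha
    rw [abs_le] at h1
    rw [hI, Finset.mem_Icc]
    constructor <;> apply Int.floor_le_floor
    · rw [← neg_div]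
      gcongr
      exact h1.1
    · gcongr
      exact h1.2
  have hfib : ∀ k ∈ Fintype.piFinset fun _ : Fin (Module.finrank ℝ V) => I,
      (S.filter fun a => code a = k).card ≤ ⌊m⌋₊ := by
    intro k _
    refine Nat.le_floor (hm _ (Finset.filter_subset _ _) fun a ha b hb => ?_)
    rw [Finset.mem_filter] at ha hb
    have hproj : ‖V.starProjection (f a - f b)‖ ≤ Module.finrank ℝ V * r := by
      have h1 : V.starProjection (f a - f b) =
          ∑ j, (inner ℝ (e j : E) (f a - f b)) • (e j : E) := by
        rw [Submodule.starProjection_apply, e.orthogonalProjectionOnto_apply_eq_sum]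
        simp
      rw [h1]
      refine (norm_sum_le _ _).trans ?_
      have h2 : ∀ j ∈ Finset.univ,
          ‖(inner ℝ (e j : E) (f a - f b)) • (e j : E)‖ ≤ r := by
        intro j _
        have hab := congrFun (ha.2.trans hb.2.symm) j
        have h3 := Int.abs_sub_lt_one_of_floor_eq_floor hab
        rw [← sub_div, ← inner_sub_right, sub_sub_sub_cancel_right, abs_div, abs_of_pos hr,
          div_lt_one hr] at h3
        rw [norm_smul, hen, mul_one]
        exact h3.le
      refine (Finset.sum_le_card_nsmul _ _ _ h2).trans (le_of_eq ?_)
      simp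
    calc ‖f a - f b‖ = ‖((f a - f b) - V.starProjection (f a - f b)) +
          V.starProjection (f a - f b)‖ := by rw [sub_add_cancel]
      _ ≤ r + Module.finrank ℝ V * r :=
        (norm_add_le _ _).trans (add_le_add (hV a ha.1 b hb.1) hproj)
      _ = _ := by ring
  have hcard := Finset.card_le_mul_card_image_of_maps_to hmaps _ hfib
  have hIcard : (I.card : ℝ) ≤ 2 * T / r + 2 := by
    have h3 : ((⌊T / r⌋ + 1 - ⌊-(T / r)⌋ : ℤ) : ℝ) ≤ 2 * T / r + 2 := by
      push_cast
      have h4 := Int.floor_le (T / r)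
      have h5 := Int.lt_floor_add_one (-(T / r))
      rw [mul_div_assoc]
      linarith
    have h9 : ((⌊T / r⌋ + 1 - ⌊-(T / r)⌋).toNat : ℤ) = ⌊T / r⌋ + 1 - ⌊-(T / r)⌋ := by
      apply Int.toNat_of_nonneg
      have : ⌊-(T / r)⌋ ≤ ⌊T / r⌋ := Int.floor_le_floor (by linarith)
      omega
    rw [hI, Int.card_Icc]
    calc (((⌊T / r⌋ + 1 - ⌊-(T / r)⌋).toNat : ℕ) : ℝ)
        = (((⌊T / r⌋ + 1 - ⌊-(T / r)⌋).toNat : ℤ) : ℝ) := by push_cast; rfl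
      _ ≤ _ := by rw [h9]; exact h3
  rw [Fintype.card_piFinset_const] at hcard
  calc (S.card : ℝ) ≤ (⌊m⌋₊ : ℝ) * (I.card : ℝ) ^ Module.finrank ℝ V := by
        exact_mod_cast hcard
    _ ≤ m * (2 * T / r + 2) ^ Module.finrank ℝ V := by
      gcongr
      exact Nat.floor_le hm0
    _ = _ := mul_comm _ _

end Filling

section Increment

open scoped Pointwise

variable {G : Type*} [AddCommGroup G] [DecidableEq G]
variable {E : Type*} [NormedAddCommGroup E] [InnerProductSpace ℝ E] [FiniteDimensional ℝ E]

/-- A regular set has small increments that are transverse to a given subspace of dimension less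
than the dimension of the set. -/
lemma exists_transverse_increment {A : Finset G} {p : G → ℝ} {ι : G →+ E} {K N δ : ℝ}
    (hK : 0 ≤ K)
    (hball : ∀ (c : E) (s : ℝ), 1 ≤ s → ((A.filter fun a => ‖ι a - c‖ ≤ s).card : ℝ) ≤ K * s ^ δ)
    (hbig : ∀ s, 1 ≤ s → s ≤ N → ∃ c, s ^ δ ≤ K * (A.filter fun a => ‖ι a - c‖ ≤ s).card)
    {n : ℕ} (hcells : ∀ ρ : ℝ, 0 < ρ → ρ ≤ 1 → ∀ (S : Finset G) (m : ℝ),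
        (∀ S' ⊆ S, (∀ a ∈ S', ∀ b ∈ S', p (a - b) ≤ ρ) → (S'.card : ℝ) ≤ m) →
        (S.card : ℝ) ≤ (7 / ρ) ^ (2 * n) * m)
    {V : Submodule ℝ E} {d : ℕ} (hVd : Module.finrank ℝ V ≤ d) (hδd : δ ≤ d)
    {r ρ R : ℝ} (hr : 1 ≤ r) (hρ : 0 < ρ) (hρ1 : ρ ≤ 1) (hR : 2 * r ≤ R) (hRN : R / 2 ≤ N)
    (hlarge : (4 * (d + 1) : ℝ) ^ d * K ^ 2 * (7 / ρ) ^ (2 * n) <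
      (R / r) ^ (δ - Module.finrank ℝ V)) :
    ∃ v ∈ A - A, p v ≤ ρ ∧ ‖ι v‖ ≤ R ∧ r < ‖ι v - V.starProjection (ι v)‖ := by
  by_contra! hcon
  set i := Module.finrank ℝ V with hi
  have hr0 : 0 < r := by linarith
  obtain ⟨c, hc⟩ := hbig (R / 2) (by linarith) hRN
  set S := A.filter fun a => ‖ι a - c‖ ≤ R / 2 with hS
  have hSc : ∀ a ∈ S, a ∈ A ∧ ‖ι a - c‖ ≤ R / 2 := fun a ha => Finset.mem_filter.1 ha
  have hcard := hcells ρ hρ hρ1 S ((2 * (R / 2) / r + 2) ^ i * (K * ((i + 1) * r) ^ δ)) ?_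
  · set x := R / r with hx
    have hx2 : 2 ≤ x := by rw [hx, le_div_iff₀ hr0]; exact hR
    have hRx : R / 2 = x / 2 * r := by rw [hx]; field_simp
    have h1 : 2 * (R / 2) / r + 2 ≤ 2 * x := by
      have : 2 * (R / 2) / r = x := by rw [hx]; ring
      linarith
    set P := (7 / ρ) ^ (2 * n) with hP
    have hP0 : 0 < P := by positivity
    have h2 : (R / 2) ^ δ ≤ K * (P * ((2 * x) ^ i * (K * ((i + 1) * r) ^ δ))) := by
      refine hc.trans (mul_le_mul_of_nonneg_left (hcard.trans ?_) hK)
      have h0 : 0 ≤ 2 * (R / 2) / r + 2 := by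
        have : 0 ≤ R := by linarith
        positivity
      gcongr
    rw [hRx, Real.mul_rpow (by linarith) hr0.le, Real.mul_rpow (by positivity) hr0.le,
      Real.div_rpow (by linarith) (by norm_num)] at h2
    have hrδ : 0 < r ^ δ := Real.rpow_pos_of_pos hr0 δ
    have h2δ : (0 : ℝ) < 2 ^ δ := Real.rpow_pos_of_pos (by norm_num) δ
    have h3 : x ^ δ ≤ 2 ^ δ * ((i : ℝ) + 1) ^ δ * 2 ^ i * x ^ i * (K ^ 2 * P) := by
      have h4 : x ^ δ / 2 ^ δ * r ^ δ ≤
          (((i : ℝ) + 1) ^ δ * 2 ^ i * x ^ i * (K ^ 2 * P)) * r ^ δ := by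
        refine h2.trans (le_of_eq ?_)
        rw [mul_pow]
        ring
      have h5 := le_of_mul_le_mul_right h4 hrδ
      rw [div_le_iff₀ h2δ] at h5
      linarith
    have h6 : (2 : ℝ) ^ δ * ((i : ℝ) + 1) ^ δ * 2 ^ i ≤ (4 * (d + 1)) ^ d := by
      have hid : (i : ℝ) ≤ d := by exact_mod_cast hVd
      rw [← Real.mul_rpow (by norm_num) (by positivity)]
      calc (2 * ((i : ℝ) + 1)) ^ δ * 2 ^ i ≤ (2 * ((i : ℝ) + 1)) ^ (d : ℝ) * 2 ^ d := by
            gcongr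
            · nlinarith [(Nat.cast_nonneg i : (0 : ℝ) ≤ i)]
            · norm_num
        _ ≤ (2 * ((d : ℝ) + 1)) ^ (d : ℝ) * 2 ^ d := by gcongr
        _ = _ := by
          rw [Real.rpow_natCast, ← mul_pow]
          ring_nf
    have hxi : x ^ δ = x ^ (δ - i) * x ^ i := by
      rw [← Real.rpow_natCast x i, ← Real.rpow_add (by linarith)]
      simp
    have hxi0 : 0 < x ^ i := by positivity
    rw [hxi] at h3
    have h7 : x ^ (δ - i) * x ^ i ≤ ((4 * (d + 1)) ^ d * K ^ 2 * P) * x ^ i := by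
      refine h3.trans ?_
      have : 0 ≤ x ^ i * (K ^ 2 * P) := by positivity
      nlinarith [mul_le_mul_of_nonneg_right h6 this]
    exact absurd (le_of_mul_le_mul_right h7 hxi0) (not_le.2 hlarge)
  · intro S' hS' hp
    refine card_le_of_near_subspace ι V hr0 (by linarith) S' c _ (fun a ha => (hSc a (hS' ha)).2)
      ?_ ?_
    · intro a ha b hb
      rw [← map_sub]
      refine hcon _ (Finset.sub_mem_sub (hSc a (hS' ha)).1 (hSc b (hS' hb)).1) (hp a ha b hb) ?_
      have h1 := (hSc a (hS' ha)).2
      have h2 := (hSc b (hS' hb)).2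
      rw [map_sub, ← sub_sub_sub_cancel_right _ _ c]
      exact (norm_sub_le _ _).trans (by linarith)
    · intro S'' hS'' hdiam
      rcases S''.eq_empty_or_nonempty with rfl | ⟨a, ha⟩
      · simp only [Finset.card_empty, Nat.cast_zero]
        positivity
      · refine le_trans ?_ (hball (ι a) ((i + 1) * r) ?_)
        · refine Nat.cast_le.2 ?_
          refine Finset.card_le_card fun b hb => Finset.mem_filter.2 ⟨(hSc b (hS' (hS'' hb))).1, ?_⟩
          exact hdiam b hb a ha
        · nlinarith [(Nat.cast_nonneg i : (0 : ℝ) ≤ i)]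

/-- A maximal separated subset controls the cardinality of a set. -/
lemma exists_separated_subset {E' : Type*} [NormedAddCommGroup E'] (A : Finset G)
    (ι : G →+ E') {s m : ℝ} (hs : 0 ≤ s)
    (hball : ∀ c : E', ((A.filter fun a => ‖ι a - c‖ ≤ s).card : ℝ) ≤ m) :
    ∃ Z ⊆ A, (∀ a ∈ Z, ∀ b ∈ Z, ‖ι a - ι b‖ ≤ s → a = b) ∧ (A.card : ℝ) ≤ Z.card * m := by
  have hne : {Z : Finset G | Z ⊆ A ∧ ∀ a ∈ Z, ∀ b ∈ Z, ‖ι a - ι b‖ ≤ s → a = b}.Nonempty :=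
    ⟨∅, by simp⟩
  have hfin : {Z : Finset G | Z ⊆ A ∧ ∀ a ∈ Z, ∀ b ∈ Z, ‖ι a - ι b‖ ≤ s → a = b}.Finite :=
    (Finset.finite_toSet A.powerset).subset fun Z hZ => by simpa using hZ.1
  obtain ⟨Z, ⟨hZA, hZ⟩, hmax⟩ := Set.exists_max_image _ Finset.card hfin hne
  refine ⟨Z, hZA, hZ, ?_⟩
  have hcover : A ⊆ Z.biUnion fun z => A.filter fun a => ‖ι a - ι z‖ ≤ s := by
    intro a ha
    by_contra hnot
    simp only [Finset.mem_biUnion, Finset.mem_filter, not_exists, not_and] at hnot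
    have haZ : a ∉ Z := fun h => hnot a h ha (by simpa using hs)
    have := hmax (insert a Z) ⟨Finset.insert_subset ha hZA, ?_⟩
    · rw [Finset.card_insert_of_notMem haZ] at this
      omega
    · intro x hx y hy hxy
      rcases Finset.mem_insert.1 hx with rfl | hx' <;> rcases Finset.mem_insert.1 hy with rfl | hy'
      · rfl
      · exact absurd hxy (hnot y hy' ha)
      · rw [norm_sub_rev] at hxy
        exact absurd hxy (hnot x hx' ha)
      · exact hZ x hx' y hy' hxy
  calc (A.card : ℝ) ≤ ∑ z ∈ Z, ((A.filter fun a => ‖ι a - ι z‖ ≤ s).card : ℝ) := by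
        exact_mod_cast (Finset.card_le_card hcover).trans Finset.card_biUnion_le
    _ ≤ ∑ z ∈ Z, m := Finset.sum_le_sum fun z _ => hball _
    _ = Z.card * m := by simp

/-- If the difference set of a regular set approximates a subspace, then the dimension of the
subspace is constrained by that of the set. -/
lemma rpow_le_of_approximatesSubspace {A : Finset G} {p : G → ℝ} {ι : G →+ E} {K N δ : ℝ}
    (hA : A.Nonempty) (hK : 0 ≤ K) (hδ : 0 < δ)
    (hball : ∀ (c : E) (s : ℝ), 1 ≤ s → ((A.filter fun a => ‖ι a - c‖ ≤ s).card : ℝ) ≤ K * s ^ δ)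
    (hbig : ∀ s, 1 ≤ s → s ≤ N → ∃ c, s ^ δ ≤ K * (A.filter fun a => ‖ι a - c‖ ≤ s).card)
    (hK5 : (((A + A + A + A + A) - (A + A + A + A + A)).card : ℝ) ≤ K * A.card)
    (hw : ∀ x ∈ weightedSums A p 1, x ∈ (A + A) - (A + A))
    {V : Submodule ℝ E} {r L : ℝ} (hV : ApproximatesSubspace A p ι V 1 r L)
    (hδV : δ < Module.finrank ℝ V) (hr : 1 ≤ r) (hL : L ≤ N)
    (hrL : 5 * r * Module.finrank ℝ V ≤ L) :
    (L / r) ^ ((Module.finrank ℝ V : ℝ) - δ) ≤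
      6 ^ δ * (10 * Module.finrank ℝ V) ^ Module.finrank ℝ V * K ^ 3 := by
  set q := Module.finrank ℝ V with hq
  have hq0 : (0 : ℝ) < q := hδ.trans hδV
  have hq1 : (1 : ℝ) ≤ q := by exact_mod_cast Nat.one_le_iff_ne_zero.2 (by exact_mod_cast hq0.ne')
  have hr0 : 0 < r := by linarith
  have hrL' : 5 * r ≤ L := by nlinarith
  have hL0 : 0 < L := by linarith
  set Q : ℕ := ⌊L / (5 * r * q)⌋₊ with hQ
  have hQle : Q * (5 * r * q) ≤ L := by
    rw [← le_div_iff₀ (by positivity)]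
    exact Nat.floor_le (by positivity)
  have hQge : L / (10 * r * q) ≤ Q := by
    have h1 : 1 ≤ L / (5 * r * q) := by rw [one_le_div (by positivity)]; exact hrL
    have h2 := Nat.lt_floor_add_one (L / (5 * r * q))
    have h3 : 1 ≤ Q := Nat.le_floor (by simpa using h1)
    have h4 : (1 : ℝ) ≤ Q := by exact_mod_cast h3
    have h5 : L / (10 * r * q) = L / (5 * r * q) / 2 := by field_simp; norm_num
    rw [h5]
    linarith
  set e := stdOrthonormalBasis ℝ V with he
  set u : (Fin q → Fin Q) → V := fun n => ∑ j, ((5 * r) * (n j : ℝ)) • e j with hu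
  have hunorm : ∀ n, ‖(u n : E)‖ ≤ L := by
    intro n
    rw [← Submodule.coe_norm]
    refine (norm_sum_le _ _).trans (le_trans ?_ hQle)
    have h2 : ∀ j ∈ Finset.univ, ‖((5 * r) * (n j : ℝ)) • e j‖ ≤ 5 * r * Q := by
      intro j _
      rw [norm_smul, e.norm_eq_one, mul_one, Real.norm_of_nonneg (by positivity)]
      gcongr
      exact (n j).2.le
    refine (Finset.sum_le_card_nsmul _ _ _ h2).trans (le_of_eq ?_)
    simp
    ring
  have husep : ∀ n n', ‖(u n : E) - u n'‖ < 5 * r → n = n' := by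
    intro n n' h
    by_contra hne
    obtain ⟨j, hj⟩ := Function.ne_iff.1 hne
    have h1 : inner ℝ (e j) (u n - u n') = 5 * r * ((n j : ℝ) - n' j) := by
      rw [inner_sub_right]
      simp only [hu]
      rw [e.orthonormal.inner_right_fintype, e.orthonormal.inner_right_fintype]
      ring
    have h2 : |inner ℝ (e j) (u n - u n')| ≤ ‖(u n : E) - u n'‖ := by
      refine (abs_real_inner_le_norm _ _).trans (le_of_eq ?_)
      rw [e.norm_eq_one, one_mul, Submodule.coe_norm, Submodule.coe_sub]
    have h3 : (1 : ℝ) ≤ |(n j : ℝ) - n' j| := by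
      have : (1 : ℤ) ≤ |((n j : ℕ) : ℤ) - (n' j : ℕ)| := by
        apply Int.one_le_abs
        have : (n j : ℕ) ≠ n' j := fun h => hj (Fin.ext h)
        omega
      exact_mod_cast this
    rw [h1, abs_mul, abs_of_pos (by positivity)] at h2
    nlinarith
  choose y hyw hyu using fun n => hV (u n) (u n).2 (hunorm n)
  obtain ⟨c, hc⟩ := hbig r hr (by linarith)
  set B := A.filter fun a => ‖ι a - c‖ ≤ r with hB
  have hBdiff : ∀ a ∈ B, ∀ b ∈ B, ‖ι a - ι b‖ ≤ 2 * r := by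
    intro a ha b hb
    have h1 := (Finset.mem_filter.1 ha).2
    have h2 := (Finset.mem_filter.1 hb).2
    rw [← sub_sub_sub_cancel_right _ _ c]
    exact (norm_sub_le _ _).trans (by linarith)
  obtain ⟨Z, hZA, hZ, hAZ⟩ := exists_separated_subset A ι (s := 6 * L) (m := K * (6 * L) ^ δ)
    (by positivity) fun c => hball c _ (by linarith)
  have hynorm : ∀ n, ‖ι (y n)‖ ≤ L + r := by
    intro n
    have := norm_add_le (ι (y n) - u n) (u n : E)
    rw [sub_add_cancel] at this
    linarith [hyu n, hunorm n]
  have hinj : ∀ z ∈ Z, ∀ z' ∈ Z, ∀ n n', ∀ a ∈ B, ∀ a' ∈ B, z + y n + a = z' + y n' + a' →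
      z = z' ∧ n = n' ∧ a = a' := by
    intro z hz z' hz' n n' a ha a' ha' h
    have hzz : z = z' := by
      refine hZ z hz z' hz' ?_
      have h1 : z - z' = (y n' - y n) + (a' - a) := by
        have : z = z' + y n' + a' - a - y n := by rw [← h]; abel
        rw [this]; abel
      rw [← map_sub, h1, map_add, map_sub, map_sub]
      have h2 := norm_sub_le (ι (y n')) (ι (y n))
      have h3 := hBdiff a' ha' a ha
      refine (norm_add_le _ _).trans ?_
      linarith [hynorm n, hynorm n']
    subst hzz
    have hya : y n + a = y n' + a' := by
      rw [add_assoc, add_assoc] at h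
      exact add_left_cancel h
    have hnn : n = n' := by
      refine husep n n' ?_
      have h1 : y n - y n' = a' - a := by
        rw [sub_eq_sub_iff_add_eq_add, hya, add_comm]
      have h2 : (u n : E) - u n' = (ι (y n') - u n') - (ι (y n) - u n) + (ι a' - ι a) := by
        rw [← map_sub ι a' a, ← h1, map_sub]
        abel
      rw [h2]
      have h3 := norm_sub_le (ι (y n') - u n') (ι (y n) - (u n : E))
      refine (norm_add_le _ _).trans_lt ?_
      linarith [hBdiff a' ha' a ha, hyu n, hyu n']
    subst hnn
    exact ⟨rfl, rfl, add_left_cancel hya⟩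
  obtain ⟨a₀, ha₀⟩ := hA
  have hcardle : Z.card * Q ^ q * B.card ≤ ((A + A + A + A + A) - (A + A + A + A + A)).card := by
    have h1 : Z.card * Q ^ q * B.card =
        ((Z ×ˢ (Finset.univ : Finset (Fin q → Fin Q))) ×ˢ B).card := by
      simp [Finset.card_product]
    rw [h1]
    refine Finset.card_le_card_of_injOn (fun x => x.1.1 + y x.1.2 + x.2 + (a₀ - (a₀ + a₀ + a₀)))
      ?_ ?_
    · rintro ⟨⟨z, n⟩, a⟩ hx
      simp only [Finset.coe_product, Set.mem_prod, Finset.mem_coe] at hx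
      obtain ⟨_, h12, _, h34, hy⟩ := Finset.mem_sub.1 (hw _ (hyw n))
      obtain ⟨a1, h1, a2, h2, rfl⟩ := Finset.mem_add.1 h12
      obtain ⟨a3, h3, a4, h4, rfl⟩ := Finset.mem_add.1 h34
      have hz := hZA hx.1.1
      have ha := (Finset.mem_filter.1 hx.2).1
      have : z + y n + a + (a₀ - (a₀ + a₀ + a₀)) =
          (z + a + a1 + a2 + a₀) - (a3 + a4 + a₀ + a₀ + a₀) := by rw [← hy]; abel
      simp only [this]
      refine Finset.sub_mem_sub ?_ ?_ <;> repeat' apply Finset.add_mem_add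
      all_goals assumption
    · rintro ⟨⟨z, n⟩, a⟩ hx ⟨⟨z', n'⟩, a'⟩ hx' h
      simp only [Finset.coe_product, Set.mem_prod, Finset.mem_coe] at hx hx'
      obtain ⟨rfl, rfl, rfl⟩ := hinj z hx.1.1 z' hx'.1.1 n n' a hx.2 a' hx'.2
        (add_right_cancel h)
      rfl
  have hZ0 : (0 : ℝ) < Z.card := by
    have : (0 : ℝ) < A.card := by exact_mod_cast Finset.card_pos.2 ⟨a₀, ha₀⟩
    by_contra hneg
    have h0 : (Z.card : ℝ) = 0 := le_antisymm (not_lt.1 hneg) (Nat.cast_nonneg _)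
    rw [h0, zero_mul] at hAZ
    linarith
  have hmain : (Q : ℝ) ^ q * r ^ δ ≤ K ^ 3 * (6 * L) ^ δ := by
    have h1 : (Z.card : ℝ) * Q ^ q * B.card ≤ K * (Z.card * (K * (6 * L) ^ δ)) := by
      refine le_trans (le_trans ?_ hK5) (mul_le_mul_of_nonneg_left hAZ hK)
      exact_mod_cast hcardle
    have h2 : (Z.card : ℝ) * (Q ^ q * B.card) ≤ Z.card * (K ^ 2 * (6 * L) ^ δ) := by
      linarith
    have h3 := le_of_mul_le_mul_left h2 hZ0
    calc (Q : ℝ) ^ q * r ^ δ ≤ Q ^ q * (K * B.card) := by gcongr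
      _ = K * (Q ^ q * B.card) := by ring
      _ ≤ K * (K ^ 2 * (6 * L) ^ δ) := by gcongr
      _ = _ := by ring
  set x := L / r with hx
  have hx0 : 0 < x := by positivity
  have hLx : L = x * r := by rw [hx]; field_simp
  have hrδ : 0 < r ^ δ := Real.rpow_pos_of_pos hr0 δ
  have h1 : x / (10 * q) ≤ Q := by
    refine le_trans (le_of_eq ?_) hQge
    rw [hx, div_div]
    ring_nf
  have h2 : (x / (10 * q)) ^ q * r ^ δ ≤ (K ^ 3 * (6 ^ δ * x ^ δ)) * r ^ δ := by
    refine le_trans ?_ (hmain.trans (le_of_eq ?_))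
    · gcongr
    · rw [hLx, Real.mul_rpow (by norm_num) (by positivity), Real.mul_rpow hx0.le hr0.le]
      ring
  have h3 := le_of_mul_le_mul_right h2 hrδ
  rw [div_pow, div_le_iff₀ (by positivity)] at h3
  rw [Real.rpow_sub hx0, Real.rpow_natCast, div_le_iff₀ (Real.rpow_pos_of_pos hx0 δ)]
  linarith

end Increment

section Core

open scoped Pointwise

/-- One step of the dimension increment. -/
lemma ApproximatesSubspace.exists_succ {G : Type*} [AddCommGroup G] [DecidableEq G]
    {E : Type*} [NormedAddCommGroup E] [InnerProductSpace ℝ E] [FiniteDimensional ℝ E]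
    {A : Finset G} {p : G → ℝ} {ι : G →+ E} {K N δ : ℝ}
    (hK : 0 ≤ K)
    (hball : ∀ (c : E) (s : ℝ), 1 ≤ s → ((A.filter fun a => ‖ι a - c‖ ≤ s).card : ℝ) ≤ K * s ^ δ)
    (hbig : ∀ s, 1 ≤ s → s ≤ N → ∃ c, s ^ δ ≤ K * (A.filter fun a => ‖ι a - c‖ ≤ s).card)
    (hp0 : ∀ x, 0 ≤ p x) (hp : ∀ x, p (-x) ≤ p x)
    {n : ℕ} (hcells : ∀ ρ : ℝ, 0 < ρ → ρ ≤ 1 → ∀ (S : Finset G) (m : ℝ),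
        (∀ S' ⊆ S, (∀ a ∈ S', ∀ b ∈ S', p (a - b) ≤ ρ) → (S'.card : ℝ) ≤ m) →
        (S.card : ℝ) ≤ (7 / ρ) ^ (2 * n) * m)
    {V : Submodule ℝ E} {d q k : ℕ} {M b t r L : ℝ} (hVd : Module.finrank ℝ V ≤ d) (hδd : δ ≤ d)
    (hq : 1 ≤ q) (hM : 12 ≤ M) (hMq : 28 * q ≤ M) (hMd : (4 * (d + 1) : ℝ) ^ d ≤ M) (hMK : K ≤ M)
    (hb0 : 0 < b) (hb : b ≤ δ - Module.finrank ℝ V) (hk : 4 * n + 4 ≤ k * b)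
    (hr : 1 ≤ r) (hLN : L ≤ N) (hrL : M ^ (k + 2) * r ≤ L)
    (hV : ApproximatesSubspace A p ι V t r L) :
    ∃ (V' : Submodule ℝ E) (r' L' : ℝ), Module.finrank ℝ V' = Module.finrank ℝ V + 1 ∧
      1 ≤ r' ∧ L' ≤ N ∧ M * r' ≤ L' ∧ ApproximatesSubspace A p ι V' (t + 1 / q) r' L' := by
  have hM0 : 0 < M := by linarith
  have hM1 : 1 ≤ M := by linarith
  have hr0 : 0 < r := by linarith
  have hq0 : (1 : ℝ) ≤ q := by exact_mod_cast hq
  have hk1 : k ≠ 0 := by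
    rintro rfl
    have : (0 : ℝ) ≤ n := Nat.cast_nonneg n
    simp at hk
    linarith
  set R := L / (6 * M) with hR
  set ρ := 1 / (4 * M * q) with hρ
  have hρ0 : 0 < ρ := by positivity
  have hρ1 : ρ ≤ 1 := by
    rw [hρ, div_le_one (by positivity)]
    nlinarith
  have h7ρ : 7 / ρ ≤ M ^ 2 := by
    have : 7 / ρ = 28 * q * M := by rw [hρ]; field_simp; norm_num
    rw [this, sq]
    gcongr
  have hLR : L = 6 * M * R := by rw [hR]; field_simp
  have hRr : M ^ k * r ≤ R := by
    rw [hR, le_div_iff₀ (by positivity)]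
    refine le_trans ?_ hrL
    have : M ^ (k + 2) * r - M ^ k * r * (6 * M) = M ^ k * r * M * (M - 6) := by ring
    have : 0 ≤ M ^ k * r * M * (M - 6) := mul_nonneg (by positivity) (by linarith)
    linarith
  have hMk : M ≤ M ^ k := le_self_pow₀ hM1 hk1
  have h2R : 2 * r ≤ R := by
    refine le_trans ?_ hRr
    gcongr
    linarith
  have hR0 : 0 < R := by linarith
  obtain ⟨v, hv, hvρ, hvR, hvr⟩ := exists_transverse_increment (p := p) hK hball hbig hcells hVd hδd
    hr hρ0 hρ1 h2R (by nlinarith) (by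
      calc (4 * (d + 1) : ℝ) ^ d * K ^ 2 * (7 / ρ) ^ (2 * n)
          ≤ M * M ^ 2 * (M ^ 2) ^ (2 * n) := by gcongr
        _ = M ^ (4 * n + 3) := by ring
        _ < M ^ (4 * n + 4) := pow_lt_pow_right₀ (by linarith) (by omega)
        _ = M ^ ((4 * n + 4 : ℕ) : ℝ) := (Real.rpow_natCast _ _).symm
        _ ≤ M ^ (k * (δ - Module.finrank ℝ V)) := by
          refine Real.rpow_le_rpow_of_exponent_le hM1 ?_
          push_cast
          refine hk.trans ?_
          gcongr
        _ = (M ^ k) ^ (δ - Module.finrank ℝ V) := by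
          rw [Real.rpow_mul hM0.le, Real.rpow_natCast]
        _ ≤ (R / r) ^ (δ - Module.finrank ℝ V) := by
          refine Real.rpow_le_rpow (by positivity) ?_ (by linarith)
          rw [le_div_iff₀ hr0]
          exact hRr)
  have hw0 : ι v - V.starProjection (ι v) ≠ 0 := by
    intro h
    rw [h, norm_zero] at hvr
    linarith
  have hwR : ‖ι v - V.starProjection (ι v)‖ ≤ R := by
    refine le_trans ?_ hvR
    have h1 := Submodule.norm_sq_eq_add_norm_sq_starProjection (ι v) V
    rw [Submodule.starProjection_orthogonal_val] at h1
    exact (abs_le_of_sq_le_sq' (by nlinarith [sq_nonneg ‖V.starProjection (ι v)‖])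
      (norm_nonneg _)).2
  have happ := hV.sup_span_singleton hp0 hp hv hvρ hvR hvr hr0.le (k := 2 * M) (by linarith)
    (by rw [hLR]; linarith)
  have hwt : 2 * (2 * M) * ρ = 1 / q := by rw [hρ]; field_simp; norm_num
  rw [hwt] at happ
  refine ⟨_, _, _, finrank_sup_span_sub_starProjection V hw0, ?_, ?_, ?_, happ⟩
  · linarith
  · nlinarith
  · linarith

set_option maxHeartbeats 1000000 in
/-- **Multiscale structure theorem.** A finite set of small doubling cannot be regular of
non-integer dimension over a long range of scales. -/
theorem exists_le_exp_of_regular (d : ℕ) {δ : ℝ} (hδ0 : 0 < δ) (hδd : δ < d)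
    (hδ : ∀ n : ℤ, δ ≠ n) :
    ∃ K₀ : ℝ, ∀ K, K₀ ≤ K → ∀ (N : ℝ) (A : Finset (Fin d → ℤ))
      (ι : (Fin d → ℤ) →+ EuclideanSpace ℝ (Fin d)), A.Nonempty →
      (∀ (c : EuclideanSpace ℝ (Fin d)) (s : ℝ), 1 ≤ s →
        ((A.filter fun a => ‖ι a - c‖ ≤ s).card : ℝ) ≤ K * s ^ δ) →
      (∀ s, 1 ≤ s → s ≤ N → ∃ c, s ^ δ ≤ K * (A.filter fun a => ‖ι a - c‖ ≤ s).card) →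
      (((A + A + A + A + A) - (A + A + A + A + A)).card : ℝ) ≤ K * A.card →
      N ≤ Real.exp (K ^ (3 * d + 2)) := by
  set m : ℕ := ⌊δ⌋₊ with hm
  have hmδ : (m : ℝ) < δ := lt_of_le_of_ne (Nat.floor_le hδ0.le) fun h =>
    hδ m (by exact_mod_cast h.symm)
  have hδm : δ < m + 1 := Nat.lt_floor_add_one δ
  have hmd : m + 1 ≤ d := by
    have : (m : ℝ) < d := hmδ.trans hδd
    exact_mod_cast this
  have hd1 : (1 : ℝ) ≤ d := by exact_mod_cast (by omega : 1 ≤ d)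
  have hmd' : (m : ℝ) + 1 ≤ d := by exact_mod_cast hmd
  set b := δ - m with hb
  have hb0 : 0 < b := by linarith
  set b' := m + 1 - δ with hb'
  have hb'0 : 0 < b' := by linarith
  set g : ℕ := ⌈5 / b'⌉₊ with hg
  have hgb : 5 ≤ g * b' := by
    rw [← div_le_iff₀ hb'0]
    exact Nat.le_ceil _
  have hg1 : 1 ≤ g := Nat.one_le_iff_ne_zero.2 (by
    intro h
    rw [h] at hgb
    norm_num at hgb)
  have hg1' : (1 : ℝ) ≤ g := by exact_mod_cast hg1
  refine ⟨12 + 28 * d + (4 * (d + 1)) ^ d + 6 ^ d * (10 * d) ^ d + g + (4100 / b + 3),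
    fun K hK N A ι hA hball hbig hK5 => ?_⟩
  have e1 : (0 : ℝ) ≤ (4 * (d + 1)) ^ d := by positivity
  have e2 : (0 : ℝ) ≤ 6 ^ d * (10 * d) ^ d := by positivity
  have e3 : (0 : ℝ) ≤ 4100 / b := by positivity
  have hK12 : 12 ≤ K := by linarith
  have hK0 : 0 < K := by linarith
  have hK1 : 1 ≤ K := by linarith
  obtain ⟨ψ, hψ⟩ := exists_addMonoidHom_ne_zero ((A + A + A + A + A) - (A + A + A + A + A))
  obtain ⟨n, p, hn, hp0, hp, hw, hcells⟩ := exists_bohr_structure hA hψ hK0 hK5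
  set k : ℕ := ⌈(4 * n + 4) / b⌉₊ with hk
  have hkb : 4 * n + 4 ≤ k * b := by
    rw [← div_le_iff₀ hb0]
    exact Nat.le_ceil _
  have hkK : ((k + 2 : ℕ) : ℝ) ≤ K ^ 3 := by
    have h1 : (k : ℝ) < (4 * n + 4) / b + 1 := Nat.ceil_lt_add_one (by positivity)
    have h2 : (4 * n + 4) / b ≤ 4100 / b * K ^ 2 := by
      rw [div_mul_eq_mul_div]
      gcongr
      nlinarith
    have h3 : (4100 / b + 3) * K ^ 2 ≤ K ^ 3 := by
      rw [pow_succ' K 2]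
      gcongr
      linarith
    push_cast
    nlinarith
  by_contra! hN
  set q := m + 1 with hq
  have hq1 : (q : ℝ) = m + 1 := by rw [hq]; push_cast; ring
  have hKN : K ^ (g * (k + 2) ^ q) ≤ N := by
    refine le_trans ?_ hN.le
    rw [← Real.exp_log hK0, ← Real.exp_nat_mul, Real.exp_log hK0]
    refine Real.exp_le_exp.2 ?_
    have h1 : Real.log K ≤ K := (Real.log_le_sub_one_of_pos hK0).trans (by linarith)
    have h2 : (((g * (k + 2) ^ q : ℕ)) : ℝ) ≤ K * (K ^ 3) ^ d := by
      rw [Nat.cast_mul, Nat.cast_pow]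
      have h3 : (g : ℝ) ≤ K := by linarith
      have h4 : ((k + 2 : ℕ) : ℝ) ^ q ≤ (K ^ 3) ^ d :=
        (pow_le_pow_left₀ (by positivity) hkK q).trans
          (pow_le_pow_right₀ (one_le_pow₀ hK1) hmd)
      exact mul_le_mul h3 h4 (by positivity) hK0.le
    calc (((g * (k + 2) ^ q : ℕ)) : ℝ) * Real.log K ≤ (K * (K ^ 3) ^ d) * K :=
          mul_le_mul h2 h1 (Real.log_nonneg hK1) (by positivity)
      _ = K ^ (3 * d + 2) := by ring
  have key : ∀ i ≤ q, ∃ (V : Submodule ℝ (EuclideanSpace ℝ (Fin d))) (r L : ℝ),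
      Module.finrank ℝ V = i ∧ 1 ≤ r ∧ L ≤ N ∧ K ^ (g * (k + 2) ^ (q - i)) * r ≤ L ∧
        ApproximatesSubspace A p ι V (i / q) r L := by
    intro i
    induction i with
    | zero =>
      intro _
      refine ⟨⊥, 1, N, by simp, le_rfl, le_rfl, by simpa using hKN, ?_⟩
      intro u hu _
      rw [Submodule.mem_bot] at hu
      exact ⟨0, zero_mem_weightedSums A p (by simp), by simp [hu]⟩
    | succ i ih =>
      intro hi
      obtain ⟨V, r, L, hVi, hr, hLN, hrL, hV⟩ := ih (by omega)
      have him : (i : ℝ) ≤ m := by exact_mod_cast (by omega : i ≤ m)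
      set M := K ^ (g * (k + 2) ^ (q - (i + 1))) with hM
      have hKM : K ≤ M := le_self_pow₀ hK1 (by positivity)
      have hMk : M ^ (k + 2) = K ^ (g * (k + 2) ^ (q - i)) := by
        rw [hM, ← pow_mul, mul_assoc, ← pow_succ]
        congr 3
        omega
      obtain ⟨V', r', L', h1, h2, h3, h4, h5⟩ := hV.exists_succ (d := d) (q := q) (k := k) (M := M)
        (b := b) hK0.le hball hbig hp0 hp hcells (by omega) hδd.le (by omega) (by linarith)
        (by rw [hq1]; linarith) (by linarith) hKM hb0 (by rw [hVi]; linarith) hkb hr hLN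
        (by rw [hMk]; exact hrL)
      refine ⟨V', r', L', by rw [h1, hVi], h2, h3, h4, ?_⟩
      have : ((i + 1 : ℕ) : ℝ) / q = i / q + 1 / q := by push_cast; ring
      rw [this]
      exact h5
  obtain ⟨V, r, L, hVq, hr, hLN, hrL, hV⟩ := key q le_rfl
  have hqd : (q : ℝ) ≤ d := by rw [hq1]; exact hmd'
  have hr0 : 0 < r := by linarith
  rw [div_self (by rw [hq1]; positivity)] at hV
  rw [Nat.sub_self, pow_zero, mul_one] at hrL
  have hKg : K ≤ K ^ g := le_self_pow₀ hK1 (by omega)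
  have hfin := rpow_le_of_approximatesSubspace hA hK0.le hδ0 hball hbig hK5 hw hV
    (by rw [hVq, hq1]; exact hδm) hr hLN (by
      rw [hVq]
      refine le_trans ?_ hrL
      have : 5 * (q : ℝ) ≤ K ^ g := by linarith
      nlinarith)
  rw [hVq] at hfin
  have hlow : K ^ 5 ≤ (L / r) ^ ((q : ℝ) - δ) := by
    calc K ^ 5 = K ^ ((5 : ℕ) : ℝ) := (Real.rpow_natCast _ _).symm
      _ ≤ K ^ (g * b') := Real.rpow_le_rpow_of_exponent_le hK1 (by exact_mod_cast hgb)
      _ = (K ^ g) ^ b' := by rw [Real.rpow_mul hK0.le, Real.rpow_natCast]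
      _ ≤ (L / r) ^ b' := by
        refine Real.rpow_le_rpow (by positivity) ?_ hb'0.le
        rw [le_div_iff₀ hr0]
        exact hrL
      _ = _ := by rw [hb', hq1]
  have hup : (6 : ℝ) ^ δ * (10 * q) ^ q ≤ K := by
    have h1 : (6 : ℝ) ^ δ ≤ 6 ^ d := by
      rw [← Real.rpow_natCast]
      exact Real.rpow_le_rpow_of_exponent_le (by norm_num) hδd.le
    have h2 : (10 * (q : ℝ)) ^ q ≤ (10 * d) ^ d :=
      (pow_le_pow_left₀ (by positivity) (by linarith) q).trans
        (pow_le_pow_right₀ (by linarith) hmd)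
    have h3 := mul_le_mul h1 h2 (by positivity) (by positivity)
    linarith
  have : K ^ 5 ≤ K ^ 4 := hlow.trans (hfin.trans (by
    rw [pow_succ' K 3]
    gcongr))
  exact absurd this (not_le.2 (pow_lt_pow_right₀ (by linarith) (by norm_num)))

end Core

section Discretization

variable {d : ℕ}

/-- The index of the cell of side length `h` containing a point. -/
noncomputable def cellIndex (h : ℝ) (x : EuclideanSpace ℝ (Fin d)) : Fin d → ℤ :=
  fun i => ⌊x i / h⌋

/-- The inclusion of the integer lattice in Euclidean space. -/
noncomputable def latticeHom (d : ℕ) : (Fin d → ℤ) →+ EuclideanSpace ℝ (Fin d) where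
  toFun z := WithLp.toLp 2 fun i => (z i : ℝ)
  map_zero' := by ext i; simp
  map_add' x y := by ext i; simp

@[simp] lemma latticeHom_apply (z : Fin d → ℤ) (i : Fin d) : latticeHom d z i = z i := rfl

lemma norm_le_of_forall_abs_le (v : EuclideanSpace ℝ (Fin d)) {t : ℝ} (h : ∀ i, |v i| ≤ t) :
    ‖v‖ ≤ d * t := by
  have hv : v = ∑ i, v i • EuclideanSpace.single i (1 : ℝ) := by
    ext j
    simp [Finset.sum_apply, Pi.single_apply]
  calc ‖v‖ = ‖∑ i, v i • EuclideanSpace.single i (1 : ℝ)‖ := by rw [← hv]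
    _ ≤ ∑ i, ‖v i • EuclideanSpace.single i (1 : ℝ)‖ := norm_sum_le _ _
    _ ≤ ∑ _i : Fin d, t := Finset.sum_le_sum fun i _ => by
      rw [norm_smul]
      simpa using h i
    _ = d * t := by simp

lemma abs_apply_le_norm (v : EuclideanSpace ℝ (Fin d)) (i : Fin d) : |v i| ≤ ‖v‖ :=
  PiLp.norm_apply_le v i

lemma norm_latticeHom_cellIndex_sub_le (h : ℝ) (x : EuclideanSpace ℝ (Fin d)) :
    ‖latticeHom d (cellIndex h x) - h⁻¹ • x‖ ≤ d := by
  rw [← mul_one (d : ℝ)]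
  refine norm_le_of_forall_abs_le _ fun i => ?_
  have h1 := Int.floor_le (x i / h)
  have h2 := Int.lt_floor_add_one (x i / h)
  have h3 : (latticeHom d (cellIndex h x) - h⁻¹ • x) i = (⌊x i / h⌋ : ℝ) - x i / h := by
    simp [cellIndex, div_eq_inv_mul]
  rw [h3, abs_le]
  constructor <;> linarith

lemma norm_sub_le_of_cellIndex_eq {h : ℝ} (hh : 0 < h) {x y : EuclideanSpace ℝ (Fin d)}
    (hxy : cellIndex h x = cellIndex h y) : ‖x - y‖ ≤ d * h := by
  refine norm_le_of_forall_abs_le _ fun i => ?_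
  have h1 := Int.abs_sub_lt_one_of_floor_eq_floor (congrFun hxy i)
  rw [← sub_div, abs_div, abs_of_pos hh, div_lt_one hh] at h1
  simpa using h1.le

/-- Only boundedly many cells meet a ball of comparable radius. -/
lemma card_le_of_cellIndex_cover {h : ℝ} (hh : 0 < h) (B : Finset (Fin d → ℤ))
    (T : Finset (EuclideanSpace ℝ (Fin d)))
    (hB : ∀ z ∈ B, ∃ x, cellIndex h x = z ∧ ∃ t ∈ T, ‖x - t‖ ≤ d * h) :
    B.card ≤ T.card * (2 * d + 1) ^ d := by
  classical
  have hsub : B ⊆ T.biUnion fun t => Fintype.piFinset fun i =>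
      Finset.Icc (⌊t i / h⌋ - d) (⌊t i / h⌋ + d) := by
    intro z hz
    obtain ⟨x, rfl, t, ht, hxt⟩ := hB z hz
    refine Finset.mem_biUnion.2 ⟨t, ht, Fintype.mem_piFinset.2 fun i => ?_⟩
    have h1 := (abs_apply_le_norm (x - t) i).trans hxt
    rw [PiLp.sub_apply, abs_le] at h1
    have h2 : x i / h ≤ t i / h + d := by
      rw [div_add' _ _ _ hh.ne']
      gcongr
      linarith
    have h3 : t i / h - d ≤ x i / h := by
      rw [div_sub' hh.ne']
      gcongr
      linarith
    rw [Finset.mem_Icc]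
    constructor
    · have := Int.floor_le_floor h3
      rwa [Int.floor_sub_natCast] at this
    · have := Int.floor_le_floor h2
      rwa [Int.floor_add_natCast] at this
  refine (Finset.card_le_card hsub).trans (Finset.card_biUnion_le_card_mul _ _ _ fun t _ => ?_)
  rw [Fintype.card_piFinset]
  refine le_of_eq ?_
  have : ∀ i : Fin d, (Finset.Icc (⌊t i / h⌋ - d) (⌊t i / h⌋ + d)).card = 2 * d + 1 := by
    intro i
    rw [Int.card_Icc]
    omega
  simp [this]

/-- The additive energy of a measure is controlled by that of its discretization. -/
lemma addEnergy_le_quadEnergy {h : ℝ} (hh : 0 < h) (μ : Measure (EuclideanSpace ℝ (Fin d)))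
    [IsFiniteMeasure μ] {A : Finset (Fin d → ℤ)} (hA : ∀ᵐ x ∂μ, cellIndex h x ∈ A) {m : ℝ≥0∞}
    (hm : ∀ z ∈ A, μ (cellIndex h ⁻¹' {z}) ≤ m) :
    addEnergy μ (d * h) ≤ (((2 * d + 5) ^ d * quadEnergy A : ℕ) : ℝ≥0∞) * m ^ 4 := by
  classical
  set F : Finset (Fin d → ℤ) := Fintype.piFinset fun _ =>
    Finset.Icc (-((d : ℤ) + 2)) ((d : ℤ) + 2) with hF
  have hFcard : F.card = (2 * d + 5) ^ d := by
    rw [hF, Fintype.card_piFinset_const, Int.card_Icc]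
    congr 1
    omega
  set Q : Finset ((Fin d → ℤ) × (Fin d → ℤ) × (Fin d → ℤ) × (Fin d → ℤ)) :=
    (A ×ˢ A ×ˢ A ×ˢ A).filter fun p => p.1 + p.2.1 - p.2.2.1 - p.2.2.2 ∈ F with hQ
  have hQcard : Q.card ≤ (2 * d + 5) ^ d * quadEnergy A := by
    have hsub : Q ⊆ F.biUnion fun f =>
        (A ×ˢ A ×ˢ A ×ˢ A).filter fun p => p.1 + p.2.1 - p.2.2.1 - p.2.2.2 = f := by
      intro p hp
      rw [hQ, Finset.mem_filter] at hp
      exact Finset.mem_biUnion.2 ⟨_, hp.2, Finset.mem_filter.2 ⟨hp.1, rfl⟩⟩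
    rw [← hFcard]
    exact (Finset.card_le_card hsub).trans
      (Finset.card_biUnion_le_card_mul _ _ _ fun f _ => card_quadruples_le A f)
  set box : (Fin d → ℤ) × (Fin d → ℤ) × (Fin d → ℤ) × (Fin d → ℤ) →
      Set (EuclideanSpace ℝ (Fin d) × EuclideanSpace ℝ (Fin d) × EuclideanSpace ℝ (Fin d) ×
        EuclideanSpace ℝ (Fin d)) := fun p =>
    (cellIndex h ⁻¹' {p.1}) ×ˢ (cellIndex h ⁻¹' {p.2.1}) ×ˢ (cellIndex h ⁻¹' {p.2.2.1}) ×ˢ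
      (cellIndex h ⁻¹' {p.2.2.2}) with hbox
  have hae : ∀ᵐ p ∂(μ.prod (μ.prod (μ.prod μ))), cellIndex h p.1 ∈ A ∧ cellIndex h p.2.1 ∈ A ∧
      cellIndex h p.2.2.1 ∈ A ∧ cellIndex h p.2.2.2 ∈ A := by
    have q1 : ∀ᵐ p ∂(μ.prod μ), cellIndex h p.1 ∈ A ∧ cellIndex h p.2 ∈ A :=
      (Measure.quasiMeasurePreserving_fst.ae hA).and (Measure.quasiMeasurePreserving_snd.ae hA)
    have q2 : ∀ᵐ p ∂(μ.prod (μ.prod μ)), cellIndex h p.1 ∈ A ∧ cellIndex h p.2.1 ∈ A ∧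
        cellIndex h p.2.2 ∈ A :=
      (Measure.quasiMeasurePreserving_fst.ae hA).and (Measure.quasiMeasurePreserving_snd.ae q1)
    exact (Measure.quasiMeasurePreserving_fst.ae hA).and
      (Measure.quasiMeasurePreserving_snd.ae q2)
  have hcover : ({p | ‖p.1 + p.2.1 - p.2.2.1 - p.2.2.2‖ ≤ d * h} :
      Set (EuclideanSpace ℝ (Fin d) × EuclideanSpace ℝ (Fin d) × EuclideanSpace ℝ (Fin d) ×
        EuclideanSpace ℝ (Fin d))) ≤ᵐ[μ.prod (μ.prod (μ.prod μ))] ⋃ p ∈ Q, box p := by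
    filter_upwards [hae] with p hp hpS
    obtain ⟨x1, x2, x3, x4⟩ := p
    simp only at hp
    obtain ⟨hp1, hp2, hp3, hp4⟩ := hp
    replace hpS : ‖x1 + x2 - x3 - x4‖ ≤ d * h := hpS
    refine Set.mem_iUnion₂.2 ⟨(cellIndex h x1, cellIndex h x2, cellIndex h x3, cellIndex h x4),
      ?_, by simp [hbox]⟩
    rw [hQ, Finset.mem_filter]
    refine ⟨by simp [hp1, hp2, hp3, hp4], ?_⟩
    rw [hF, Fintype.mem_piFinset]
    intro i
    have h1 := (abs_apply_le_norm _ i).trans hpS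
    simp only [PiLp.sub_apply, PiLp.add_apply] at h1
    have h2 : |x1 i / h + x2 i / h - x3 i / h - x4 i / h| ≤ d := by
      rw [← add_div, ← sub_div, ← sub_div, abs_div, abs_of_pos hh, div_le_iff₀ hh]
      exact h1
    rw [abs_le] at h2
    have a1 := Int.floor_le (x1 i / h)
    have a2 := Int.floor_le (x2 i / h)
    have a3 := Int.floor_le (x3 i / h)
    have a4 := Int.floor_le (x4 i / h)
    have b1 := Int.lt_floor_add_one (x1 i / h)
    have b2 := Int.lt_floor_add_one (x2 i / h)
    have b3 := Int.lt_floor_add_one (x3 i / h)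
    have b4 := Int.lt_floor_add_one (x4 i / h)
    simp only [Pi.sub_apply, Pi.add_apply, cellIndex, Finset.mem_Icc]
    constructor
    · have : (-((d : ℝ) + 2)) ≤
          (⌊x1 i / h⌋ : ℝ) + ⌊x2 i / h⌋ - ⌊x3 i / h⌋ - ⌊x4 i / h⌋ := by linarith
      exact_mod_cast this
    · have : (⌊x1 i / h⌋ : ℝ) + ⌊x2 i / h⌋ - ⌊x3 i / h⌋ - ⌊x4 i / h⌋ ≤ (d : ℝ) + 2 := by linarith
      exact_mod_cast this
  calc addEnergy μ (d * h) ≤ (μ.prod (μ.prod (μ.prod μ))) (⋃ p ∈ Q, box p) := measure_mono_ae hcover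
    _ ≤ ∑ p ∈ Q, (μ.prod (μ.prod (μ.prod μ))) (box p) := measure_biUnion_finset_le _ _
    _ ≤ ∑ _p ∈ Q, m ^ 4 := by
      refine Finset.sum_le_sum fun p hp => ?_
      rw [hQ, Finset.mem_filter] at hp
      simp only [Finset.mem_product] at hp
      obtain ⟨⟨h1, h2, h3, h4⟩, -⟩ := hp
      simp only [hbox, Measure.prod_prod]
      calc _ ≤ m * (m * (m * m)) :=
            mul_le_mul' (hm _ h1) (mul_le_mul' (hm _ h2) (mul_le_mul' (hm _ h3) (hm _ h4)))
        _ = m ^ 4 := by ring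
    _ = (Q.card : ℝ≥0∞) * m ^ 4 := by simp
    _ ≤ _ := by
      gcongr

end Discretization

section Assembly

open scoped Pointwise

lemma quadEnergy_le_card_pow_three {G : Type*} [AddCommGroup G] [DecidableEq G] (A : Finset G) :
    quadEnergy A ≤ A.card ^ 3 := by
  calc quadEnergy A ≤ ∑ s ∈ A - A, A.card * (diffSlice A s).card := by
        refine Finset.sum_le_sum fun s _ => ?_
        rw [sq]
        exact Nat.mul_le_mul_right _ (Finset.card_le_card (Finset.filter_subset _ _))
    _ ≤ A.card * A.card ^ 2 := by
        rw [← Finset.mul_sum]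
        exact Nat.mul_le_mul_left _ (sum_card_diffSlice_le A)
    _ = A.card ^ 3 := by ring

lemma card_five_sub_five_le {G : Type*} [AddCommGroup G] [DecidableEq G] {A : Finset G}
    (hA : A.Nonempty) {M : ℝ} (h : ((A - A).card : ℝ) ≤ M * A.card) :
    (((A + A + A + A + A) - (A + A + A + A + A)).card : ℝ) ≤ M ^ 10 * A.card := by
  have h5 : A + A + A + A + A = 5 • A := by
    simp only [succ_nsmul, zero_nsmul, zero_add]
  rw [h5]
  have hpos : (0 : ℝ) < A.card := by exact_mod_cast hA.card_pos
  have key := Finset.pluennecke_ruzsa_inequality_nsmul_sub_nsmul_sub hA A 5 5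
  have key' : ((5 • A - 5 • A).card : ℝ) ≤ (((A - A).card : ℝ) / A.card) ^ 10 * A.card := by
    have hcast := (NNRat.cast_le (K := ℝ)).2 key
    push_cast at hcast
    exact hcast
  refine key'.trans ?_
  gcongr
  rwa [div_le_iff₀ hpos]

variable {d : ℕ}

lemma finite_image_cellIndex {h : ℝ} (hh : 0 < h) {X : Set (EuclideanSpace ℝ (Fin d))}
    (hX : X ⊆ closedBall 0 1) : (cellIndex h '' X).Finite := by
  refine (Set.finite_Icc (fun _ => ⌊-1 / h⌋ : Fin d → ℤ) (fun _ => ⌊1 / h⌋)).subset ?_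
  rintro _ ⟨x, hx, rfl⟩
  have hx1 : ‖x‖ ≤ 1 := by simpa using hX hx
  have hxi : ∀ i, |x i| ≤ 1 := fun i => (abs_apply_le_norm x i).trans hx1
  refine ⟨fun i => Int.floor_le_floor ?_, fun i => Int.floor_le_floor ?_⟩
  · exact div_le_div_of_nonneg_right (abs_le.1 (hxi i)).1 hh.le
  · exact div_le_div_of_nonneg_right (abs_le.1 (hxi i)).2 hh.le

/-- A set is upper regular between the scales `r` and `1`. -/
def UpperRegular (X : Set (EuclideanSpace ℝ (Fin d))) (C δ r : ℝ) : Prop :=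
  ∀ r₁ r₂ : ℝ, r ≤ r₂ → r₂ ≤ r₁ → r₁ ≤ 1 → ∀ x : EuclideanSpace ℝ (Fin d),
    ∃ T : Finset (EuclideanSpace ℝ (Fin d)), (T.card : ℝ) ≤ C * (r₁ / r₂) ^ δ ∧
      X ∩ closedBall x r₁ ⊆ ⋃ t ∈ T, closedBall t r₂

lemma UpperRegular.card_cells_le {X : Set (EuclideanSpace ℝ (Fin d))} {C δ h r₁ : ℝ}
    (hX : UpperRegular X C δ (d * h)) (hh : 0 < h) (h1 : d * h ≤ r₁) (h2 : r₁ ≤ 1)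
    (x₀ : EuclideanSpace ℝ (Fin d)) (B : Finset (Fin d → ℤ))
    (hB : ∀ z ∈ B, ∃ x ∈ X, cellIndex h x = z ∧ ‖x - x₀‖ ≤ r₁) :
    (B.card : ℝ) ≤ (2 * d + 1) ^ d * (C * (r₁ / (d * h)) ^ δ) := by
  obtain ⟨T, hT, hcov⟩ := hX r₁ (d * h) le_rfl h1 h2 x₀
  have key : B.card ≤ T.card * (2 * d + 1) ^ d := by
    refine card_le_of_cellIndex_cover hh B T fun z hz => ?_
    obtain ⟨x, hxX, hxz, hx⟩ := hB z hz
    have := hcov ⟨hxX, by rwa [mem_closedBall, dist_eq_norm]⟩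
    simp only [Set.mem_iUnion, mem_closedBall, dist_eq_norm, exists_prop] at this
    exact ⟨x, hxz, this⟩
  have key' : (B.card : ℝ) ≤ T.card * (2 * d + 1) ^ d := by exact_mod_cast key
  rw [mul_comm]
  exact key'.trans (by gcongr)

lemma UpperRegular.card_filter_le {X : Set (EuclideanSpace ℝ (Fin d))} {C δ h : ℝ}
    (hX : UpperRegular X C δ (d * h)) (hX1 : X ⊆ closedBall 0 1) (hd : 1 ≤ d) (hh : 0 < h)
    (hr : d * h ≤ 1) (hC : 0 ≤ C) (hδ : 0 ≤ δ) (A : Finset (Fin d → ℤ))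
    (hA : ∀ z ∈ A, ∃ x ∈ X, cellIndex h x = z) (c : EuclideanSpace ℝ (Fin d)) {s : ℝ}
    (hs : 1 ≤ s) :
    ((A.filter fun a => ‖latticeHom d a - c‖ ≤ s).card : ℝ) ≤
      (2 * d + 1) ^ d * (C * (2 * s) ^ δ) := by
  have hd' : (1 : ℝ) ≤ d := by exact_mod_cast hd
  have hr0 : 0 < d * h := by positivity
  have hnear : ∀ z ∈ A.filter fun a => ‖latticeHom d a - c‖ ≤ s,
      ∃ x ∈ X, cellIndex h x = z ∧ ‖x - h • c‖ ≤ d * h * (2 * s) := by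
    intro z hz
    rw [Finset.mem_filter] at hz
    obtain ⟨x, hxX, rfl⟩ := hA z hz.1
    refine ⟨x, hxX, rfl, ?_⟩
    have e1 := norm_latticeHom_cellIndex_sub_le h x
    have e2 : ‖h⁻¹ • x - c‖ ≤ d + s := by
      have := norm_sub_le_norm_sub_add_norm_sub (h⁻¹ • x) (latticeHom d (cellIndex h x)) c
      rw [norm_sub_rev] at e1
      linarith [hz.2]
    have e3 : x - h • c = h • (h⁻¹ • x - c) := by
      rw [smul_sub, smul_smul, mul_inv_cancel₀ hh.ne', one_smul]
    rw [e3, norm_smul, Real.norm_of_nonneg hh.le]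
    calc h * ‖h⁻¹ • x - c‖ ≤ h * (d + s) := by gcongr
      _ ≤ h * (d * s + d * s) := by
        gcongr
        · nlinarith
        · nlinarith
      _ = d * h * (2 * s) := by ring
  by_cases hs2 : d * h * (2 * s) ≤ 1
  · have := hX.card_cells_le hh (by nlinarith) hs2 (h • c) _ hnear
    rwa [mul_div_cancel_left₀ _ hr0.ne'] at this
  · push Not at hs2
    have := hX.card_cells_le hh hr le_rfl 0 (A.filter fun a => ‖latticeHom d a - c‖ ≤ s) (by
      intro z hz
      obtain ⟨x, hxX, hxz, -⟩ := hnear z hz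
      exact ⟨x, hxX, hxz, by simpa using hX1 hxX⟩)
    refine this.trans ?_
    gcongr
    rw [div_le_iff₀ hr0]
    linarith

lemma UpperRegular.exists_le_card_filter {X : Set (EuclideanSpace ℝ (Fin d))} {C δ h : ℝ}
    (hX : UpperRegular X C δ (d * h)) (hX1 : X ⊆ closedBall 0 1) (hd : 1 ≤ d) (hh : 0 < h)
    {A : Finset (Fin d → ℤ)} (hAne : A.Nonempty)
    (hA : ∀ z ∈ A, ∃ x ∈ X, cellIndex h x = z) {s : ℝ} (hs : 2 * d ≤ s)
    (hs1 : d * h * s ≤ 1) :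
    ∃ c, A.card * (d * h * s) ^ δ ≤
      C * (2 * d) ^ δ * (A.filter fun a => ‖latticeHom d a - c‖ ≤ s).card := by
  classical
  have hd' : (1 : ℝ) ≤ d := by exact_mod_cast hd
  have hs0 : 0 < s := by linarith
  have hρ : d * h ≤ h * s / 2 := by nlinarith
  have hρ1 : h * s / 2 ≤ 1 := by nlinarith [mul_pos hh hs0]
  obtain ⟨T, hT, hcov⟩ := hX 1 (h * s / 2) hρ hρ1 le_rfl 0
  have hsub : A ⊆ T.biUnion fun t => A.filter fun a => ‖latticeHom d a - h⁻¹ • t‖ ≤ s := by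
    intro z hz
    obtain ⟨x, hxX, rfl⟩ := hA z hz
    have := hcov ⟨hxX, hX1 hxX⟩
    simp only [Set.mem_iUnion, mem_closedBall, dist_eq_norm, exists_prop] at this
    obtain ⟨t, ht, hxt⟩ := this
    refine Finset.mem_biUnion.2 ⟨t, ht, Finset.mem_filter.2 ⟨hz, ?_⟩⟩
    have e1 := norm_latticeHom_cellIndex_sub_le h x
    have e2 : ‖h⁻¹ • x - h⁻¹ • t‖ ≤ s / 2 := by
      rw [← smul_sub, norm_smul, Real.norm_of_nonneg (inv_nonneg.2 hh.le), inv_mul_le_iff₀ hh]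
      linarith
    have := norm_sub_le_norm_sub_add_norm_sub (latticeHom d (cellIndex h x)) (h⁻¹ • x) (h⁻¹ • t)
    linarith
  have hTne : T.Nonempty := by
    by_contra hcon
    rw [Finset.not_nonempty_iff_eq_empty] at hcon
    rw [hcon, Finset.biUnion_empty, Finset.subset_empty] at hsub
    exact hAne.ne_empty hsub
  obtain ⟨t, -, htmax⟩ := T.exists_max_image
    (fun t => (A.filter fun a => ‖latticeHom d a - h⁻¹ • t‖ ≤ s).card) hTne
  refine ⟨h⁻¹ • t, ?_⟩
  have hcard := (Finset.card_le_card hsub).trans (Finset.card_biUnion_le_card_mul _ _ _ htmax)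
  have hcard' : (A.card : ℝ) ≤ T.card *
      (A.filter fun a => ‖latticeHom d a - h⁻¹ • t‖ ≤ s).card := by exact_mod_cast hcard
  have hq : (1 / (h * s / 2)) ^ δ * (d * h * s) ^ δ = (2 * d) ^ δ := by
    rw [← Real.mul_rpow (by positivity) (by positivity)]
    congr 1
    field_simp
  calc A.card * (d * h * s) ^ δ ≤ (C * (1 / (h * s / 2)) ^ δ *
      (A.filter fun a => ‖latticeHom d a - h⁻¹ • t‖ ≤ s).card) * (d * h * s) ^ δ := by
        refine mul_le_mul_of_nonneg_right (hcard'.trans ?_) (by positivity)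
        gcongr
    _ = C * ((1 / (h * s / 2)) ^ δ * (d * h * s) ^ δ) *
      (A.filter fun a => ‖latticeHom d a - h⁻¹ • t‖ ≤ s).card := by ring
    _ = _ := by rw [hq]

set_option maxHeartbeats 1000000 in
/-- Combinatorial consequences of a large energy at scale `r`. -/
lemma le_exp_of_large_quadEnergy {δ C ε h K₀ : ℝ} (hd : 1 ≤ d) (hδ0 : 0 < δ) (hδd : δ < d)
    (hK₀ : ∀ K, K₀ ≤ K → ∀ (N : ℝ) (A : Finset (Fin d → ℤ))
      (ι : (Fin d → ℤ) →+ EuclideanSpace ℝ (Fin d)), A.Nonempty →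
      (∀ (c : EuclideanSpace ℝ (Fin d)) (s : ℝ), 1 ≤ s →
        ((A.filter fun a => ‖ι a - c‖ ≤ s).card : ℝ) ≤ K * s ^ δ) →
      (∀ s, 1 ≤ s → s ≤ N → ∃ c, s ^ δ ≤ K * (A.filter fun a => ‖ι a - c‖ ≤ s).card) →
      (((A + A + A + A + A) - (A + A + A + A + A)).card : ℝ) ≤ K * A.card →
      N ≤ Real.exp (K ^ (3 * d + 2)))
    (hC : 1 < C) (hε : 0 < ε) (hε2 : ε ≤ 1 / 2) (hh : 0 < h) (hr : d * h ≤ 1)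
    {X : Set (EuclideanSpace ℝ (Fin d))} (hX1 : X ⊆ closedBall 0 1)
    (hX : UpperRegular X C δ (d * h)) {A : Finset (Fin d → ℤ)}
    (hA : ∀ z ∈ A, ∃ x ∈ X, cellIndex h x = z)
    (hQ : ε * (d * h) ^ δ < ((2 * d + 5) ^ d * quadEnergy A : ℕ) * (C * (d * h) ^ δ) ^ 4)
    {K : ℝ} (hKK₀ : K₀ ≤ K)
    (hK : (2 ^ 16 * ((2 * d + 5) ^ d * (C / ε)) ^ 32) ^ 10 ≤ K) :
    (d * h)⁻¹ ≤ Real.exp (K ^ (3 * d + 2)) := by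
  have hd' : (1 : ℝ) ≤ d := by exact_mod_cast hd
  have hr0 : 0 < d * h := by positivity
  set r := d * h with hrdef
  set Λ : ℝ := (2 * d + 5) ^ d with hΛ
  set P := C / ε with hP
  set L := Λ * P with hL
  have hΛ1 : 1 ≤ Λ := one_le_pow₀ (by linarith)
  have hCP : C ≤ P := by
    rw [hP, le_div_iff₀ hε]
    nlinarith
  have hP1 : 1 ≤ P := by linarith
  have hεP : 1 / ε ≤ P := by
    rw [hP]
    gcongr
  have hPL : P ≤ L := le_mul_of_one_le_left (by linarith) hΛ1
  have hΛL : Λ ≤ L := le_mul_of_one_le_right (by linarith) hP1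
  have hL1 : 1 ≤ L := by linarith
  have hC0 : 0 < C := by linarith
  have hDΛ : ((2 * d + 1) ^ d : ℝ) ≤ Λ := by
    rw [hΛ]
    gcongr
    norm_num
  have hdΛ : (2 * d : ℝ) ^ δ ≤ Λ := by
    calc (2 * d : ℝ) ^ δ ≤ (2 * d : ℝ) ^ (d : ℝ) :=
          Real.rpow_le_rpow_of_exponent_le (by linarith) hδd.le
      _ = (2 * d : ℝ) ^ d := Real.rpow_natCast _ _
      _ ≤ Λ := by
        rw [hΛ]
        gcongr
        linarith
  have h2Λ : (2 : ℝ) ^ δ ≤ Λ :=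
    (Real.rpow_le_rpow (by norm_num) (by linarith) hδ0.le).trans hdΛ
  set R := r ^ δ with hR
  have hR0 : 0 < R := Real.rpow_pos_of_pos hr0 _
  set K1 := L ^ 8 with hK1
  have hKK1 : (2 ^ 16 * K1 ^ 4) ^ 10 ≤ K := by
    rw [hK1, ← pow_mul]
    exact hK
  have hLK1 : ∀ n ≤ 8, L ^ n ≤ K1 := fun n hn => pow_le_pow_right₀ hL1 hn
  have hK11 : 1 ≤ K1 := one_le_pow₀ hL1
  have hK140 : 2 ^ 160 * K1 ^ 40 ≤ K := by
    refine le_trans (le_of_eq ?_) hKK1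
    ring
  have hK1n : ∀ n ≤ 40, 2 ^ 160 * K1 ^ n ≤ K := fun n hn =>
    (mul_le_mul_of_nonneg_left (pow_le_pow_right₀ hK11 hn) (by positivity)).trans hK140
  have hK0 : 1 ≤ K := by
    have := hK1n 0 (by norm_num)
    norm_num at this
    linarith
  have hQ1 : ε < Λ * quadEnergy A * C ^ 4 * R ^ 3 := by
    have e : ((((2 * d + 5) ^ d * quadEnergy A : ℕ) : ℝ)) = Λ * quadEnergy A := by
      rw [hΛ]
      push_cast
      ring
    rw [e] at hQ
    refine lt_of_mul_lt_mul_right (hQ.trans_eq ?_) hR0.le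
    ring
  have hAne : A.Nonempty := by
    by_contra hcon
    rw [Finset.not_nonempty_iff_eq_empty] at hcon
    subst hcon
    have : quadEnergy (∅ : Finset (Fin d → ℤ)) = 0 := by simp [quadEnergy]
    rw [this] at hQ1
    simp only [Nat.cast_zero, mul_zero, zero_mul] at hQ1
    linarith
  have hcard : A.card * R ≤ Λ * C := by
    have := hX.card_cells_le hh hr le_rfl 0 A (by
      intro z hz
      obtain ⟨x, hxX, hxz⟩ := hA z hz
      exact ⟨x, hxX, hxz, by simpa using hX1 hxX⟩)
    have e : (1 / (d * h)) ^ δ = R⁻¹ := by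
      rw [← hrdef, one_div, Real.inv_rpow hr0.le]
    rw [e] at this
    calc (A.card : ℝ) * R ≤ (2 * d + 1) ^ d * (C * R⁻¹) * R := by gcongr
      _ = (2 * d + 1) ^ d * C := by field_simp
      _ ≤ Λ * C := by gcongr
  have hEpos : (0 : ℝ) < 1 / ε := by positivity
  have hL4 : Λ ^ 4 * C ^ 7 * (1 / ε) ≤ K1 := by
    calc Λ ^ 4 * C ^ 7 * (1 / ε) ≤ Λ ^ 8 * P ^ 7 * P := by
          gcongr
          norm_num
      _ = K1 := by rw [hK1, hL]; ring
  have hBSG : (A.card : ℝ) ^ 3 ≤ K1 * quadEnergy A := by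
    have e1 : (A.card : ℝ) ^ 3 * R ^ 3 ≤ (Λ * C) ^ 3 := by
      rw [← mul_pow]
      gcongr
    have e2 : (Λ * C) ^ 3 * ε ≤ (Λ * C) ^ 3 * (Λ * quadEnergy A * C ^ 4 * R ^ 3) := by gcongr
    have e3 : (A.card : ℝ) ^ 3 ≤ Λ ^ 4 * C ^ 7 * (1 / ε) * quadEnergy A := by
      have hR3 : 0 < R ^ 3 * ε := by positivity
      refine le_of_mul_le_mul_right ?_ hR3
      calc (A.card : ℝ) ^ 3 * (R ^ 3 * ε) = (A.card : ℝ) ^ 3 * R ^ 3 * ε := by ring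
        _ ≤ (Λ * C) ^ 3 * ε := by gcongr
        _ ≤ _ := e2
        _ = _ := by field_simp
    exact e3.trans (by gcongr)
  obtain ⟨A', hA'A, hA'card, hA'diff⟩ := balog_szemeredi_gowers hAne hK11 hBSG
  have hA'ne : A'.Nonempty := by
    by_contra hcon
    rw [Finset.not_nonempty_iff_eq_empty] at hcon
    rw [hcon, Finset.card_empty, Nat.cast_zero, mul_zero] at hA'card
    have : (0 : ℝ) < A.card := by exact_mod_cast hAne.card_pos
    linarith
  have hA'X : ∀ z ∈ A', ∃ x ∈ X, cellIndex h x = z := fun z hz => hA z (hA'A hz)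
  have hAR : 1 ≤ K1 * (A.card * R) := by
    have e1 : (quadEnergy A : ℝ) ≤ (A.card : ℝ) ^ 3 := by
      exact_mod_cast quadEnergy_le_card_pow_three A
    have e2 : 1 ≤ Λ ^ 4 * C ^ 7 * (1 / ε) * (A.card * R) ^ 3 := by
      have : ε ≤ Λ * C ^ 4 * (A.card * R) ^ 3 := by
        calc ε ≤ Λ * quadEnergy A * C ^ 4 * R ^ 3 := hQ1.le
          _ ≤ Λ * (A.card : ℝ) ^ 3 * C ^ 4 * R ^ 3 := by gcongr
          _ = _ := by ring
      calc (1 : ℝ) = ε * (1 / ε) := by field_simp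
        _ ≤ Λ * C ^ 4 * (A.card * R) ^ 3 * (1 / ε) := by gcongr
        _ ≤ Λ ^ 4 * C ^ 7 * (A.card * R) ^ 3 * (1 / ε) := by
          gcongr
          · exact le_self_pow₀ hΛ1 (by norm_num)
          · exact hC.le
          · norm_num
        _ = _ := by ring
    by_contra! hcon
    have e3 : (A.card : ℝ) * R ≤ 1 := by
      have : (0 : ℝ) ≤ A.card * R := by positivity
      nlinarith
    have e4 : (A.card * R) ^ 3 ≤ (A.card : ℝ) * R :=
      pow_le_of_le_one (by positivity) e3 (by norm_num)
    have : Λ ^ 4 * C ^ 7 * (1 / ε) * (A.card * R) ^ 3 ≤ K1 * (A.card * R) := by gcongr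
    linarith
  have hA'R : 1 ≤ 8 * K1 ^ 2 * (A'.card * R) := by
    calc 1 ≤ K1 * (A.card * R) := hAR
      _ ≤ K1 * (8 * K1 * A'.card * R) := by gcongr
      _ = _ := by ring
  clear_value K1 L P Λ R
  refine hK₀ K hKK₀ r⁻¹ A' (latticeHom d) hA'ne ?_ ?_ ?_
  · intro c s hs
    refine (hX.card_filter_le hX1 hd hh hr hC0.le hδ0.le A' hA'X c hs).trans ?_
    rw [Real.mul_rpow (by norm_num) (by linarith)]
    calc ((2 * d + 1) ^ d : ℝ) * (C * (2 ^ δ * s ^ δ)) ≤ L * (L * (L * s ^ δ)) := by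
          gcongr
          · exact hDΛ.trans hΛL
          · exact hCP.trans hPL
          · exact h2Λ.trans hΛL
      _ = L ^ 3 * s ^ δ := by ring
      _ ≤ K * s ^ δ := by
        gcongr
        have := hLK1 3 (by norm_num)
        have h1 := hK1n 1 (by norm_num)
        norm_num at h1
        linarith
  · intro s hs hsr
    rcases le_or_gt (2 * d : ℝ) s with hs2 | hs2
    · have hrs : d * h * s ≤ 1 := by
        rw [← hrdef]
        calc r * s ≤ r * r⁻¹ := by gcongr
          _ = 1 := mul_inv_cancel₀ hr0.ne'
      obtain ⟨c, hc⟩ := hX.exists_le_card_filter hX1 hd hh hA'ne hA'X hs2 hrs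
      refine ⟨c, ?_⟩
      set f : ℝ := ((A'.filter fun a => ‖latticeHom d a - c‖ ≤ s).card : ℝ) with hf
      have hf0 : 0 ≤ f := Nat.cast_nonneg _
      rw [← hrdef, Real.mul_rpow hr0.le (by linarith), ← hR] at hc
      have hsδ : 0 < s ^ δ := Real.rpow_pos_of_pos (by linarith) _
      calc s ^ δ ≤ 8 * K1 ^ 2 * (A'.card * R) * s ^ δ := le_mul_of_one_le_left hsδ.le hA'R
        _ = 8 * K1 ^ 2 * (A'.card * (R * s ^ δ)) := by ring
        _ ≤ 8 * K1 ^ 2 * (C * (2 * d) ^ δ * f) := by gcongr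
        _ ≤ 8 * K1 ^ 2 * (L * L * f) := by
          gcongr
          · exact hCP.trans hPL
          · exact hdΛ.trans hΛL
        _ = 8 * K1 ^ 2 * L ^ 2 * f := by ring
        _ ≤ 8 * K1 ^ 2 * K1 * f := by
          gcongr
          exact hLK1 2 (by norm_num)
        _ = 8 * K1 ^ 3 * f := by ring
        _ ≤ K * f := by
          gcongr
          have h1 := hK1n 3 (by norm_num)
          have h2 : 0 ≤ K1 ^ 3 := by positivity
          norm_num at h1
          linarith
    · obtain ⟨a, ha⟩ := hA'ne
      refine ⟨latticeHom d a, ?_⟩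
      have h1 : (1 : ℝ) ≤ (A'.filter fun b => ‖latticeHom d b - latticeHom d a‖ ≤ s).card := by
        have : 0 < (A'.filter fun b => ‖latticeHom d b - latticeHom d a‖ ≤ s).card :=
          Finset.card_pos.2 ⟨a, Finset.mem_filter.2 ⟨ha, by simp; linarith⟩⟩
        exact_mod_cast this
      calc s ^ δ ≤ (2 * d) ^ δ := by gcongr
        _ ≤ L := hdΛ.trans hΛL
        _ ≤ K1 := by simpa using hLK1 1 (by norm_num)
        _ ≤ K := by
          have h1 := hK1n 1 (by norm_num)
          norm_num at h1
          linarith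
        _ ≤ _ := le_mul_of_one_le_right (by linarith) h1
  · refine (card_five_sub_five_le hA'ne hA'diff).trans ?_
    gcongr

/-- A large energy at scale `d * h` forces the scale not to be too small. -/
lemma le_exp_of_large_addEnergy {δ C ε h K₀ : ℝ} (hd : 1 ≤ d) (hδ0 : 0 < δ) (hδd : δ < d)
    (hK₀ : ∀ K, K₀ ≤ K → ∀ (N : ℝ) (A : Finset (Fin d → ℤ))
      (ι : (Fin d → ℤ) →+ EuclideanSpace ℝ (Fin d)), A.Nonempty →
      (∀ (c : EuclideanSpace ℝ (Fin d)) (s : ℝ), 1 ≤ s →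
        ((A.filter fun a => ‖ι a - c‖ ≤ s).card : ℝ) ≤ K * s ^ δ) →
      (∀ s, 1 ≤ s → s ≤ N → ∃ c, s ^ δ ≤ K * (A.filter fun a => ‖ι a - c‖ ≤ s).card) →
      (((A + A + A + A + A) - (A + A + A + A + A)).card : ℝ) ≤ K * A.card →
      N ≤ Real.exp (K ^ (3 * d + 2)))
    (hC : 1 < C) (hε : 0 < ε) (hε2 : ε ≤ 1 / 2) (hh : 0 < h) (hr : d * h ≤ 1)
    {X : Set (EuclideanSpace ℝ (Fin d))} (hXc : IsCompact X) (hX1 : X ⊆ closedBall 0 1)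
    (hX : UpperRegular X C δ (d * h)) {μ : Measure (EuclideanSpace ℝ (Fin d))}
    (hμK : ∀ K : Set (EuclideanSpace ℝ (Fin d)), IsCompact K → μ K < ⊤) (hμX : μ Xᶜ = 0)
    (hμ : ∀ x, μ (closedBall x (d * h)) ≤ ENNReal.ofReal (C * (d * h) ^ δ))
    (hE : ENNReal.ofReal (ε * (d * h) ^ δ) < addEnergy μ (d * h))
    {K : ℝ} (hKK₀ : K₀ ≤ K)
    (hK : (2 ^ 16 * ((2 * d + 5) ^ d * (C / ε)) ^ 32) ^ 10 ≤ K) :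
    (d * h)⁻¹ ≤ Real.exp (K ^ (3 * d + 2)) := by
  have hd' : (1 : ℝ) ≤ d := by exact_mod_cast hd
  have hr0 : 0 < d * h := by positivity
  have hfin : IsFiniteMeasure μ := ⟨by
    rw [← Set.union_compl_self X]
    refine (measure_union_le _ _).trans_lt ?_
    rw [hμX, add_zero]
    exact hμK X hXc⟩
  set A := (finite_image_cellIndex hh hX1).toFinset with hAdef
  have hA : ∀ z, z ∈ A ↔ ∃ x ∈ X, cellIndex h x = z := fun z => by
    rw [hAdef, Set.Finite.mem_toFinset]
    rfl
  have hAae : ∀ᵐ x ∂μ, cellIndex h x ∈ A := by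
    have : ∀ᵐ x ∂μ, x ∈ X := hμX
    filter_upwards [this] with x hx
    exact (hA _).2 ⟨x, hx, rfl⟩
  have hm : ∀ z ∈ A, μ (cellIndex h ⁻¹' {z}) ≤ ENNReal.ofReal (C * (d * h) ^ δ) := by
    intro z hz
    obtain ⟨x, -, rfl⟩ := (hA z).1 hz
    refine (measure_mono fun y hy => ?_).trans (hμ x)
    rw [mem_closedBall, dist_eq_norm]
    exact norm_sub_le_of_cellIndex_eq hh hy
  refine le_exp_of_large_quadEnergy hd hδ0 hδd hK₀ hC hε hε2 hh hr hX1 hX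
    (fun z hz => (hA z).1 hz) ?_ hKK₀ hK
  have key := hE.trans_le (addEnergy_le_quadEnergy hh μ hAae hm)
  rw [← ENNReal.ofReal_pow (by positivity), ← ENNReal.ofReal_natCast,
    ← ENNReal.ofReal_mul (Nat.cast_nonneg _)] at key
  exact (ENNReal.ofReal_lt_ofReal_iff_of_nonneg (by positivity)).1 key

end Assembly

/-- **Slight energy gain under upper regularity hypotheses (induction hypothesis).**
Let `0 < δ < d` be a non-integer.  There are `K₁, K₂ > 0` depending only on `δ, d` with
the following property.  For `C > 1` and `0 < ε ≤ 1/2`, set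
`r₀ = exp(-exp(K₁ (log(C/ε))^{K₂}))`.  If `X ⊆ B(0,1) ⊆ ℝᵈ` is compact and upper
`δ`-regular (any `X ∩ B(x,r₁)` is covered by at most `C (r₁/r₂)^δ` balls of radius `r₂`
for `r₀ ≤ r₂ ≤ r₁ ≤ 1`), and `μ` is a Radon measure supported on `X` with
`μ(B(x,r₁)) ≤ C r₁^δ` for all `r₀ ≤ r₁ ≤ 1`, then `E(μ, r₀) ≤ ε r₀^δ`. -/
theorem slight_gain_induction_hypothesis :
    ∀ (d : ℕ), 1 ≤ d → ∀ δ : ℝ, 0 < δ → δ < d → (∀ n : ℤ, δ ≠ n) →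
      ∃ K₁ K₂ : ℝ, 0 < K₁ ∧ 0 < K₂ ∧
        ∀ C ε : ℝ, 1 < C → 0 < ε → ε ≤ 1 / 2 →
          ∀ (X : Set (EuclideanSpace ℝ (Fin d))) (μ : Measure (EuclideanSpace ℝ (Fin d))),
            IsCompact X → X ⊆ closedBall 0 1 →
            (∀ r₁ r₂ : ℝ,
              Real.exp (-Real.exp (K₁ * Real.log (C / ε) ^ K₂)) ≤ r₂ → r₂ ≤ r₁ → r₁ ≤ 1 →
              ∀ x : EuclideanSpace ℝ (Fin d),
                ∃ T : Finset (EuclideanSpace ℝ (Fin d)),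
                  (T.card : ℝ) ≤ C * (r₁ / r₂) ^ δ ∧
                  X ∩ closedBall x r₁ ⊆ ⋃ t ∈ T, closedBall t r₂) →
            (∀ K : Set (EuclideanSpace ℝ (Fin d)), IsCompact K → μ K < ⊤) →
            μ Xᶜ = 0 →
            (∀ (x : EuclideanSpace ℝ (Fin d)) (r₁ : ℝ),
              Real.exp (-Real.exp (K₁ * Real.log (C / ε) ^ K₂)) ≤ r₁ → r₁ ≤ 1 →
              μ (closedBall x r₁) ≤ ENNReal.ofReal (C * r₁ ^ δ)) →
            addEnergy μ (Real.exp (-Real.exp (K₁ * Real.log (C / ε) ^ K₂))) ≤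
              ENNReal.ofReal
                (ε * Real.exp (-Real.exp (K₁ * Real.log (C / ε) ^ K₂)) ^ δ) := by
  intro d hd δ hδ0 hδd hδ
  obtain ⟨K₀, hK₀⟩ := exists_le_exp_of_regular d hδ0 hδd hδ
  obtain ⟨k, hk⟩ := pow_unbounded_of_one_lt
    (max K₀ ((2 ^ 16 * ((2 * d + 5) ^ d) ^ 32) ^ 10)) (one_lt_two : (1 : ℝ) < 2)
  set n := (k + 320) * (3 * d + 2) + 1 with hn
  refine ⟨n, 1, by positivity, one_pos, fun C ε hC hε hε2 X μ hXc hX1 hX hμK hμX hμ => ?_⟩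
  have hP2 : 2 ≤ C / ε := by
    rw [le_div_iff₀ hε]
    linarith
  have hP0 : 0 < C / ε := by linarith
  have hexp : Real.exp (n * Real.log (C / ε) ^ (1 : ℝ)) = (C / ε) ^ n := by
    rw [Real.rpow_one, ← Real.log_pow, Real.exp_log (by positivity)]
  rw [hexp] at hX hμ ⊢
  set r := Real.exp (-(C / ε) ^ n) with hr
  have hr0 : 0 < r := Real.exp_pos _
  have hr1 : r ≤ 1 := Real.exp_le_one_iff.2 (neg_nonpos.2 (by positivity))
  have hd0 : (0 : ℝ) < d := by exact_mod_cast hd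
  have hrd : d * (r / d) = r := mul_div_cancel₀ _ hd0.ne'
  by_contra! hcon
  have hPk : (2 : ℝ) ^ k ≤ (C / ε) ^ k := by gcongr
  have hP320 : 1 ≤ (C / ε) ^ 320 := one_le_pow₀ (by linarith)
  have h1 : K₀ ≤ (C / ε) ^ (k + 320) := by
    rw [pow_add]
    have := (le_max_left K₀ _).trans (hk.le.trans hPk)
    exact this.trans (le_mul_of_one_le_right (by positivity) hP320)
  have h2 : (2 ^ 16 * ((2 * d + 5) ^ d * (C / ε)) ^ 32) ^ 10 ≤ (C / ε) ^ (k + 320) := by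
    have := (le_max_right K₀ _).trans (hk.le.trans hPk)
    calc (2 ^ 16 * ((2 * d + 5) ^ d * (C / ε)) ^ 32) ^ 10
        = (2 ^ 16 * ((2 * d + 5) ^ d) ^ 32) ^ 10 * (C / ε) ^ 320 := by
          rw [mul_pow _ (C / ε), ← mul_assoc, mul_pow _ ((C / ε) ^ 32), ← pow_mul (C / ε)]
      _ ≤ (C / ε) ^ k * (C / ε) ^ 320 := by gcongr
      _ = _ := by rw [pow_add]
  have key : (d * (r / d))⁻¹ ≤ Real.exp (((C / ε) ^ (k + 320)) ^ (3 * d + 2)) := by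
    refine le_exp_of_large_addEnergy hd hδ0 hδd hK₀ hC hε hε2 (div_pos hr0 hd0) (hrd.trans_le hr1)
      hXc hX1 ?_ hμK hμX ?_ ?_ h1 h2
    · rw [hrd]
      exact hX
    · rw [hrd]
      exact fun x => hμ x r le_rfl hr1
    · rw [hrd]
      exact hcon
  rw [hrd, hr, ← Real.exp_neg, neg_neg, Real.exp_le_exp, ← pow_mul, hn, pow_succ] at key
  have hpos : 0 < (C / ε) ^ ((k + 320) * (3 * d + 2)) := by positivity
  exact absurd key (not_le.2 (lt_mul_of_one_lt_right hpos (one_lt_two.trans_le hP2)))
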